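/- arXiv:math/9201288 — 2 statements merged into one kernel-verified Lean document; each statement's English description precedes it below -/
import Mathlib

section
/- Suppose f is on the boundary of hyperbolicity BH and f̃ = h_γ ∘ f ∘ h_γ^{−1} is the representation of f in the singular metric associated to f. Then the scaling function s_{f̃} of f̃ and the scaling function s_f of f both exist, and they satisfy: (a) s_{f̃} is Hölder continuous on the dual Cantor set C*; (b) s_f has a jump discontinuity at every point of A (the limit of s_f(b*) as b* → a*, b* ≠ a*, exists and differs from s_f(a*)) and s_f is continuous at every point of B; (c) the restriction of s_f to B equals the restriction of s_{f̃} to B. -/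
open Set MeasureTheory Filter Topology

noncomputable def len (s : Set ℝ) : ℝ := (volume s).toReal

noncomputable def branch (f : ℝ → ℝ) : Bool → ℝ → ℝ
  | false => Function.invFunOn f (Icc (-1) 0)
  | true => Function.invFunOn f (Icc 0 1)

noncomputable def gw (f : ℝ → ℝ) : List Bool → ℝ → ℝ
  | [] => id
  | b :: w => branch f b ∘ gw f w

noncomputable def Iw (f : ℝ → ℝ) (w : List Bool) : Set ℝ := gw f w '' Icc (-1) 1

def word (a : ℕ → Bool) (n : ℕ) : List Bool := ((List.range (n + 1)).reverse).map a

noncomputable def ratio (f : ℝ → ℝ) (a : ℕ → Bool) (n : ℕ) : ℝ :=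
  len (Iw f (word a n)) / len (Iw f ((word a n).dropLast))

def IsScalingFun (f : ℝ → ℝ) (s : (ℕ → Bool) → ℝ) : Prop :=
  ∀ a : ℕ → Bool, Tendsto (ratio f a) atTop (nhds (s a))

def HolderOnDual (s : (ℕ → Bool) → ℝ) : Prop :=
  ∃ C > (0:ℝ), ∃ lam ∈ Ioo (0:ℝ) 1, ∀ a b : ℕ → Bool, ∀ n : ℕ,
    (∀ k < n, a k = b k) → |s a - s b| ≤ C * lam ^ n

def EvZero (a : ℕ → Bool) : Prop := ∃ N, ∀ n ≥ N, a n = false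

def Lambda (f : ℝ → ℝ) : Set ℝ := {x | ∀ n : ℕ, f^[n] x ∈ Icc (-1) 1}

structure GoodFamily where
  eps0 : ℝ
  eps0_pos : 0 < eps0
  f : ℝ → ℝ → ℝ
  f' : ℝ → ℝ → ℝ
  gamma : ℝ
  one_lt_gamma : 1 < gamma
  mono : ∀ ε ∈ Icc 0 eps0, StrictMonoOn (f ε) (Icc (-1) 0)
  anti : ∀ ε ∈ Icc 0 eps0, StrictAntiOn (f ε) (Icc 0 1)
  map_neg_one : ∀ ε ∈ Icc 0 eps0, f ε (-1) = -1
  map_one : ∀ ε ∈ Icc 0 eps0, f ε 1 = -1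
  map_zero : ∀ ε ∈ Icc 0 eps0, f ε 0 = 1 + ε
  smooth : ContDiffOn ℝ 1 (fun p : ℝ × ℝ => f p.1 p.2) (Icc 0 eps0 ×ˢ Icc (-1) 1)
  deriv_f : ∀ ε ∈ Icc 0 eps0, ∀ x ∈ Icc (-1:ℝ) 1,
    HasDerivWithinAt (f ε) (f' ε x) (Icc (-1) 1) x
  Rneg : ℝ → ℝ → ℝ
  Rpos : ℝ → ℝ → ℝ
  Rneg_cont : ContinuousOn (fun p : ℝ × ℝ => Rneg p.1 p.2) (Icc 0 eps0 ×ˢ Icc (-1) 0)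
  Rpos_cont : ContinuousOn (fun p : ℝ × ℝ => Rpos p.1 p.2) (Icc 0 eps0 ×ˢ Icc 0 1)
  Rneg_ne : ∀ ε ∈ Icc 0 eps0, ∀ x ∈ Icc (-1:ℝ) 0, Rneg ε x ≠ 0
  Rpos_ne : ∀ ε ∈ Icc 0 eps0, ∀ x ∈ Icc (0:ℝ) 1, Rpos ε x ≠ 0
  Rneg_eq : ∀ ε ∈ Icc 0 eps0, ∀ x ∈ Ico (-1:ℝ) 0, Rneg ε x = f' ε x / |x| ^ (gamma - 1)
  Rpos_eq : ∀ ε ∈ Icc 0 eps0, ∀ x ∈ Ioc (0:ℝ) 1, Rpos ε x = f' ε x / |x| ^ (gamma - 1)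
  K' : ℝ
  K'_pos : 0 < K'
  alpha' : ℝ
  alpha'_mem : alpha' ∈ Ioc (0:ℝ) 1
  holder' : ∀ ε ∈ Icc 0 eps0, ∀ x ∈ Icc (-1:ℝ) 1, ∀ y ∈ Icc (-1:ℝ) 1,
    |f' ε x - f' ε y| ≤ K' * |x - y| ^ alpha'
  K'' : ℝ
  K''_pos : 0 < K''
  alpha'' : ℝ
  alpha''_mem : alpha'' ∈ Ioc (0:ℝ) 1
  holder''_neg : ∀ ε ∈ Icc 0 eps0, ∀ x ∈ Ico (-1:ℝ) 0, ∀ y ∈ Ico (-1:ℝ) 0,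
    |f' ε x / |x| ^ (gamma - 1) - f' ε y / |y| ^ (gamma - 1)| ≤ K'' * |x - y| ^ alpha''
  holder''_pos : ∀ ε ∈ Icc 0 eps0, ∀ x ∈ Ioc (0:ℝ) 1, ∀ y ∈ Ioc (0:ℝ) 1,
    |f' ε x / |x| ^ (gamma - 1) - f' ε y / |y| ^ (gamma - 1)| ≤ K'' * |x - y| ^ alpha''
  C0 : ℝ
  C0_pos : 0 < C0
  lam : ℝ
  lam_mem : lam ∈ Ioo (0:ℝ) 1
  decay : ∀ ε ∈ Icc 0 eps0, ∀ n : ℕ, 1 ≤ n → ∀ w : List Bool, w.length = n + 1 →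
    len (Iw (f ε) w) ≤ C0 * lam ^ n

/-- The change of coordinate `h_γ` associated to the singular metric
`dy = dx/(1-x²)^{(γ-1)/γ}` on `[-1,1]`. -/
noncomputable def hgam (γ : ℝ) (x : ℝ) : ℝ :=
  -1 + (2 / ∫ t in (-1:ℝ)..1, ((1 - t ^ 2) ^ ((γ - 1) / γ))⁻¹) *
    ∫ t in (-1:ℝ)..x, ((1 - t ^ 2) ^ ((γ - 1) / γ))⁻¹

/-- The inverse of `h_γ` on `[-1,1]`. -/
noncomputable def hgamInv (γ : ℝ) : ℝ → ℝ := Function.invFunOn (hgam γ) (Icc (-1) 1)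

/-- The representation `f̃ = h_γ ∘ f ∘ h_γ⁻¹` of `f` in the singular metric associated
to `f`. -/
noncomputable def tildeF (γ : ℝ) (f : ℝ → ℝ) : ℝ → ℝ := hgam γ ∘ f ∘ hgamInv γ


/-- The density of the singular metric. -/
noncomputable def singDensity (γ t : ℝ) : ℝ := ((1 - t ^ 2) ^ ((γ - 1) / γ))⁻¹

noncomputable def singNorm (γ : ℝ) : ℝ := 2 / ∫ t in (-1:ℝ)..1, singDensity γ t

section SingularMetric

variable {γ : ℝ}

lemma exponent_pos (hγ : 1 < γ) : 0 < (γ - 1) / γ := div_pos (by linarith) (by linarith)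

lemma exponent_eq (hγ : 1 < γ) : (γ - 1) / γ = 1 - γ⁻¹ := by
  have : γ ≠ 0 := by linarith
  field_simp

lemma exponent_lt_one (hγ : 1 < γ) : (γ - 1) / γ < 1 := by
  rw [exponent_eq hγ]
  have : 0 < γ⁻¹ := by positivity
  linarith

lemma singDensity_eq {t : ℝ} (ht : t ∈ Icc (-1:ℝ) 1) :
    singDensity γ t = (1 + t) ^ (-((γ - 1) / γ)) * (1 - t) ^ (-((γ - 1) / γ)) := by
  have h1 : 0 ≤ 1 + t := by linarith [ht.1]
  have h2 : 0 ≤ 1 - t := by linarith [ht.2]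
  rw [singDensity, show 1 - t ^ 2 = (1 + t) * (1 - t) by ring, Real.mul_rpow h1 h2, mul_inv,
    Real.rpow_neg h1, Real.rpow_neg h2]

lemma singDensity_neg (t : ℝ) : singDensity γ (-t) = singDensity γ t := by
  simp [singDensity]

lemma singDensity_nonneg {t : ℝ} (ht : t ∈ Icc (-1:ℝ) 1) : 0 ≤ singDensity γ t := by
  have : 0 ≤ 1 - t ^ 2 := by nlinarith [ht.1, ht.2]
  exact inv_nonneg.2 (Real.rpow_nonneg this _)

lemma singDensity_pos {t : ℝ} (ht : t ∈ Ioo (-1:ℝ) 1) : 0 < singDensity γ t := by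
  have : 0 < 1 - t ^ 2 := by nlinarith [ht.1, ht.2]
  exact inv_pos.2 (Real.rpow_pos_of_pos this _)

lemma singDensity_le_left (hγ : 1 < γ) {t : ℝ} (ht : t ∈ Icc (-1:ℝ) 0) :
    singDensity γ t ≤ (1 + t) ^ (-((γ - 1) / γ)) := by
  rw [singDensity_eq ⟨ht.1, by linarith [ht.2]⟩]
  refine mul_le_of_le_one_right (Real.rpow_nonneg (by linarith [ht.1]) _) ?_
  exact Real.rpow_le_one_of_one_le_of_nonpos (by linarith [ht.2]) (by linarith [exponent_pos hγ])

lemma singDensity_le (hγ : 1 < γ) {t : ℝ} (ht : t ∈ Icc (-1:ℝ) 1) :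
    singDensity γ t ≤ (1 + t) ^ (-((γ - 1) / γ)) + (1 - t) ^ (-((γ - 1) / γ)) := by
  have h1 : 0 ≤ (1 + t) ^ (-((γ - 1) / γ)) := Real.rpow_nonneg (by linarith [ht.1]) _
  have h2 : 0 ≤ (1 - t) ^ (-((γ - 1) / γ)) := Real.rpow_nonneg (by linarith [ht.2]) _
  rcases le_total t 0 with h | h
  · linarith [singDensity_le_left hγ ⟨ht.1, h⟩]
  · have := singDensity_le_left hγ (t := -t) ⟨by linarith [ht.2], by linarith⟩
    rw [singDensity_neg] at this
    rw [← sub_eq_add_neg] at this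
    linarith

lemma intervalIntegrable_left (hγ : 1 < γ) (x y : ℝ) :
    IntervalIntegrable (fun t : ℝ => (1 + t) ^ (-((γ - 1) / γ))) volume x y := by
  have h := (intervalIntegral.intervalIntegrable_rpow' (a := 1 + x) (b := 1 + y)
    (r := -((γ - 1) / γ)) (by linarith [exponent_lt_one hγ])).comp_add_left 1
  simpa using h

lemma intervalIntegrable_right (hγ : 1 < γ) (x y : ℝ) :
    IntervalIntegrable (fun t : ℝ => (1 - t) ^ (-((γ - 1) / γ))) volume x y := by
  have h := (intervalIntegral.intervalIntegrable_rpow' (a := 1 - x) (b := 1 - y)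
    (r := -((γ - 1) / γ)) (by linarith [exponent_lt_one hγ])).comp_sub_left 1
  simpa using h

lemma integral_left (hγ : 1 < γ) (x y : ℝ) :
    ∫ t in x..y, (1 + t) ^ (-((γ - 1) / γ)) = γ * ((1 + y) ^ γ⁻¹ - (1 + x) ^ γ⁻¹) := by
  rw [intervalIntegral.integral_comp_add_left (fun t : ℝ => t ^ (-((γ - 1) / γ))),
    integral_rpow (Or.inl (by linarith [exponent_lt_one hγ])), exponent_eq hγ,
    show -(1 - γ⁻¹) + 1 = γ⁻¹ by ring]
  field_simp

lemma integral_right (hγ : 1 < γ) (x y : ℝ) :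
    ∫ t in x..y, (1 - t) ^ (-((γ - 1) / γ)) = γ * ((1 - x) ^ γ⁻¹ - (1 - y) ^ γ⁻¹) := by
  rw [intervalIntegral.integral_comp_sub_left (fun t : ℝ => t ^ (-((γ - 1) / γ))),
    integral_rpow (Or.inl (by linarith [exponent_lt_one hγ])), exponent_eq hγ,
    show -(1 - γ⁻¹) + 1 = γ⁻¹ by ring]
  field_simp

lemma intervalIntegrable_singDensity (hγ : 1 < γ) {x y : ℝ} (hx : x ∈ Icc (-1:ℝ) 1)
    (hy : y ∈ Icc (-1:ℝ) 1) : IntervalIntegrable (singDensity γ) volume x y := by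
  refine IntervalIntegrable.mono_fun'
    ((intervalIntegrable_left hγ x y).add (intervalIntegrable_right hγ x y)) ?_ ?_
  · have : Measurable (singDensity γ) := by
      unfold singDensity
      fun_prop
    exact this.aestronglyMeasurable
  · refine (ae_restrict_iff' measurableSet_uIoc).2 (ae_of_all _ fun t ht => ?_)
    have ht' : t ∈ Icc (-1:ℝ) 1 := uIcc_subset_Icc hx hy (uIoc_subset_uIcc ht)
    simpa [Real.norm_of_nonneg (singDensity_nonneg ht')] using singDensity_le hγ ht'

lemma integral_singDensity_pos (hγ : 1 < γ) {x y : ℝ} (hx : x ∈ Icc (-1:ℝ) 1)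
    (hy : y ∈ Icc (-1:ℝ) 1) (h : x < y) : 0 < ∫ t in x..y, singDensity γ t :=
  intervalIntegral.intervalIntegral_pos_of_pos_on (intervalIntegrable_singDensity hγ hx hy)
    (fun _ ht => singDensity_pos ⟨by linarith [ht.1, hx.1], by linarith [ht.2, hy.2]⟩) h

lemma singNorm_pos (hγ : 1 < γ) : 0 < singNorm γ :=
  div_pos two_pos (integral_singDensity_pos hγ (by simp) (by simp) (by norm_num))

lemma hgam_sub (hγ : 1 < γ) {x y : ℝ} (hx : x ∈ Icc (-1:ℝ) 1) (hy : y ∈ Icc (-1:ℝ) 1) :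
    hgam γ y - hgam γ x = singNorm γ * ∫ t in x..y, singDensity γ t := by
  have h1 : (-1:ℝ) ∈ Icc (-1:ℝ) 1 := by simp
  rw [← intervalIntegral.integral_add_adjacent_intervals
    (intervalIntegrable_singDensity hγ hx h1) (intervalIntegrable_singDensity hγ h1 hy),
    intervalIntegral.integral_symm]
  unfold hgam singNorm singDensity
  ring

lemma hgam_neg_one : hgam γ (-1) = -1 := by simp [hgam]

lemma hgam_one (hγ : 1 < γ) : hgam γ 1 = 1 := by
  have h := hgam_sub hγ (x := -1) (y := 1) (by simp) (by simp)
  have h2 := integral_singDensity_pos hγ (x := -1) (y := 1) (by simp) (by simp) (by norm_num)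
  rw [hgam_neg_one, singNorm, div_mul_cancel₀ _ h2.ne'] at h
  linarith

lemma hgam_neg (hγ : 1 < γ) {x : ℝ} (hx : x ∈ Icc (-1:ℝ) 1) : hgam γ (-x) = -hgam γ x := by
  have hx' : -x ∈ Icc (-1:ℝ) 1 := ⟨by linarith [hx.2], by linarith [hx.1]⟩
  have h1 := hgam_sub hγ (x := -1) (by simp) hx'
  have h2 := hgam_sub hγ (y := 1) hx (by simp)
  have h3 := intervalIntegral.integral_comp_neg (a := x) (b := 1) (singDensity γ)
  simp only [singDensity_neg] at h3
  rw [← h3, ← h2, hgam_one hγ, hgam_neg_one] at h1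
  linarith

lemma hgam_zero (hγ : 1 < γ) : hgam γ 0 = 0 := by
  have := hgam_neg hγ (x := 0) (by simp)
  rw [neg_zero] at this
  linarith

lemma strictMonoOn_hgam (hγ : 1 < γ) : StrictMonoOn (hgam γ) (Icc (-1) 1) := by
  intro x hx y hy h
  have := mul_pos (singNorm_pos hγ) (integral_singDensity_pos hγ hx hy h)
  rw [← hgam_sub hγ hx hy] at this
  linarith

lemma rpow_sub_rpow_le (hγ : 1 < γ) {a b : ℝ} (ha : 0 ≤ a) (hab : a ≤ b) :
    b ^ γ⁻¹ - a ^ γ⁻¹ ≤ (b - a) ^ γ⁻¹ := by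
  have := Real.rpow_add_le_add_rpow (p := γ⁻¹) ha (sub_nonneg.2 hab) (by positivity)
    (inv_le_one_of_one_le₀ hγ.le)
  rw [add_sub_cancel] at this
  linarith

lemma hgam_holder (hγ : 1 < γ) {x y : ℝ} (hx : x ∈ Icc (-1:ℝ) 1) (hy : y ∈ Icc (-1:ℝ) 1) :
    |hgam γ x - hgam γ y| ≤ singNorm γ * (2 * γ) * |x - y| ^ γ⁻¹ := by
  wlog h : x ≤ y generalizing x y
  · rw [abs_sub_comm, abs_sub_comm x]
    exact this hy hx (le_of_not_ge h)
  rw [abs_sub_comm, abs_sub_comm x, abs_of_nonneg (sub_nonneg.2 h),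
    abs_of_nonneg (sub_nonneg.2 ((strictMonoOn_hgam hγ).monotoneOn hx hy h)), hgam_sub hγ hx hy,
    mul_assoc]
  refine mul_le_mul_of_nonneg_left ?_ (singNorm_pos hγ).le
  have h1 := intervalIntegral.integral_mono_on h (intervalIntegrable_singDensity hγ hx hy)
    ((intervalIntegrable_left hγ x y).add (intervalIntegrable_right hγ x y))
    (fun t ht => singDensity_le hγ ⟨by linarith [ht.1, hx.1], by linarith [ht.2, hy.2]⟩)
  rw [intervalIntegral.integral_add (intervalIntegrable_left hγ x y)
    (intervalIntegrable_right hγ x y), integral_left hγ, integral_right hγ] at h1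
  have h2 := rpow_sub_rpow_le hγ (a := 1 + x) (b := 1 + y) (by linarith [hx.1]) (by linarith)
  have h3 := rpow_sub_rpow_le hγ (a := 1 - y) (b := 1 - x) (by linarith [hy.2]) (by linarith)
  rw [show 1 + y - (1 + x) = y - x by ring] at h2
  rw [show 1 - x - (1 - y) = y - x by ring] at h3
  nlinarith

lemma continuousOn_hgam (hγ : 1 < γ) : ContinuousOn (hgam γ) (Icc (-1) 1) := by
  have := intervalIntegral.continuousOn_primitive_interval' (a := -1)
    (intervalIntegrable_singDensity hγ (x := -1) (y := 1) (by simp) (by simp)) (by simp)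
  rw [uIcc_of_le (by norm_num)] at this
  exact continuousOn_const.add (continuousOn_const.mul this)

lemma hgam_add_one_le (hγ : 1 < γ) {x : ℝ} (hx : x ∈ Icc (-1:ℝ) 0) :
    hgam γ x + 1 ≤ singNorm γ * (γ * (1 + x) ^ γ⁻¹) := by
  have h1 : (-1:ℝ) ∈ Icc (-1:ℝ) 1 := by simp
  have hx' : x ∈ Icc (-1:ℝ) 1 := ⟨hx.1, by linarith [hx.2]⟩
  have h := hgam_sub hγ h1 hx'
  rw [hgam_neg_one, sub_neg_eq_add] at h
  rw [h]
  refine mul_le_mul_of_nonneg_left ?_ (singNorm_pos hγ).le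
  refine (intervalIntegral.integral_mono_on hx.1 (intervalIntegrable_singDensity hγ h1 hx')
    (intervalIntegrable_left hγ _ _)
    (fun t ht => singDensity_le_left hγ ⟨ht.1, by linarith [ht.2, hx.2]⟩)).trans ?_
  have : (0:ℝ) < γ⁻¹ := by positivity
  rw [integral_left hγ]
  simp [Real.zero_rpow this.ne']

lemma singDensity_antitone (hγ : 1 < γ) {s t : ℝ} (hs : -1 < s) (hst : s ≤ t) (ht : t ≤ 0) :
    singDensity γ t ≤ singDensity γ s := by
  have h0 : 0 < 1 - s ^ 2 := by nlinarith
  exact inv_anti₀ (Real.rpow_pos_of_pos h0 _)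
    (Real.rpow_le_rpow h0.le (by nlinarith) (exponent_pos hγ).le)

lemma hgam_sub_bounds (hγ : 1 < γ) {c d x y : ℝ} (hc : -1 < c) (hcx : c ≤ x) (hxy : x ≤ y)
    (hyd : y ≤ d) (hd : d ≤ 0) :
    singNorm γ * ((y - x) * singDensity γ d) ≤ hgam γ y - hgam γ x ∧
      hgam γ y - hgam γ x ≤ singNorm γ * ((y - x) * singDensity γ c) := by
  have hx : x ∈ Icc (-1:ℝ) 1 := ⟨by linarith, by linarith⟩
  have hy : y ∈ Icc (-1:ℝ) 1 := ⟨by linarith, by linarith⟩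
  have hi := intervalIntegrable_singDensity hγ hx hy
  rw [hgam_sub hγ hx hy]
  have h1 := intervalIntegral.integral_mono_on hxy
    (intervalIntegrable_const (c := singDensity γ d)) hi
    (fun t ht => singDensity_antitone hγ (by linarith [ht.1]) (by linarith [ht.2]) hd)
  have h2 := intervalIntegral.integral_mono_on hxy hi
    (intervalIntegrable_const (c := singDensity γ c))
    (fun t ht => singDensity_antitone hγ hc (by linarith [ht.1]) (by linarith [ht.2]))
  rw [intervalIntegral.integral_const, smul_eq_mul] at h1 h2
  exact ⟨mul_le_mul_of_nonneg_left h1 (singNorm_pos hγ).le,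
    mul_le_mul_of_nonneg_left h2 (singNorm_pos hγ).le⟩

lemma singDensity_le_mul_div (hγ : 1 < γ) {c d : ℝ} (hc : -1 < c) (hcd : c ≤ d) (hd : d ≤ 0) :
    singDensity γ c ≤ singDensity γ d * ((1 + d) / (1 + c)) := by
  have hc' : 0 < 1 + c := by linarith
  have hd' : 0 < 1 + d := by linarith
  have hβ := exponent_pos hγ
  rw [singDensity_eq ⟨hc.le, by linarith⟩, singDensity_eq ⟨by linarith, by linarith⟩]
  have h1 : (1 - c) ^ (-((γ - 1) / γ)) ≤ (1 - d) ^ (-((γ - 1) / γ)) :=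
    Real.rpow_le_rpow_of_nonpos (by linarith) (by linarith) (by linarith)
  have h2 : ((1 + d) / (1 + c)) ^ ((γ - 1) / γ) ≤ (1 + d) / (1 + c) := by
    have := Real.rpow_le_rpow_of_exponent_le (x := (1 + d) / (1 + c))
      ((one_le_div hc').2 (by linarith)) (exponent_lt_one hγ).le
    rwa [Real.rpow_one] at this
  have h3 : (1 + c) ^ (-((γ - 1) / γ)) =
      (1 + d) ^ (-((γ - 1) / γ)) * ((1 + d) / (1 + c)) ^ ((γ - 1) / γ) := by
    rw [Real.div_rpow hd'.le hc'.le, Real.rpow_neg hc'.le, Real.rpow_neg hd'.le]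
    have := (Real.rpow_pos_of_pos hd' ((γ - 1) / γ)).ne'
    field_simp
  have h4 : 0 ≤ (1 + d) ^ (-((γ - 1) / γ)) := Real.rpow_nonneg hd'.le _
  have h5 : 0 ≤ (1 - d) ^ (-((γ - 1) / γ)) := Real.rpow_nonneg (by linarith) _
  calc (1 + c) ^ (-((γ - 1) / γ)) * (1 - c) ^ (-((γ - 1) / γ))
      ≤ (1 + c) ^ (-((γ - 1) / γ)) * (1 - d) ^ (-((γ - 1) / γ)) :=
        mul_le_mul_of_nonneg_left h1 (Real.rpow_nonneg hc'.le _)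
    _ ≤ ((1 + d) ^ (-((γ - 1) / γ)) * ((1 + d) / (1 + c))) * (1 - d) ^ (-((γ - 1) / γ)) := by
        rw [h3]
        gcongr
    _ = _ := by ring

lemma sub_le_of_hgam_sub_le (hγ : 1 < γ) {c d ε : ℝ} (hc : -1 < c) (hcd : c ≤ d) (hd : d ≤ 0)
    (hε : 0 ≤ ε) (h : hgam γ d - hgam γ c ≤ ε * (hgam γ c + 1)) :
    d - c ≤ 2 * γ * ε * (1 + d) := by
  have hc' : 0 < 1 + c := by linarith
  have hd' : 0 < 1 + d := by linarith
  have hn := singNorm_pos hγ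
  have hβ := exponent_pos hγ
  have h1 := (hgam_sub_bounds hγ hc le_rfl hcd le_rfl hd).1
  have h2 := hgam_add_one_le hγ (x := c) ⟨hc.le, by linarith⟩
  have h3 : (1 + c) ^ γ⁻¹ ≤ (1 + d) ^ γ⁻¹ :=
    Real.rpow_le_rpow hc'.le (by linarith) (by positivity)
  have h4 : singNorm γ * ((d - c) * singDensity γ d) ≤
      singNorm γ * (ε * (γ * (1 + d) ^ γ⁻¹)) := by
    calc _ ≤ ε * (hgam γ c + 1) := h1.trans h
      _ ≤ ε * (singNorm γ * (γ * (1 + d) ^ γ⁻¹)) := by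
        refine mul_le_mul_of_nonneg_left (h2.trans ?_) hε
        gcongr
      _ = _ := by ring
  have h5 := le_of_mul_le_mul_left h4 hn
  have h6 : (1 + d) ^ (-((γ - 1) / γ)) * 2⁻¹ ≤ singDensity γ d := by
    rw [singDensity_eq ⟨by linarith, by linarith⟩]
    refine mul_le_mul_of_nonneg_left ?_ (Real.rpow_nonneg hd'.le _)
    calc (2:ℝ)⁻¹ ≤ (1 - d)⁻¹ := inv_anti₀ (by linarith) (by linarith)
      _ = (1 - d) ^ (-1 : ℝ) := (Real.rpow_neg_one _).symm
      _ ≤ _ := Real.rpow_le_rpow_of_exponent_le (by linarith)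
        (by linarith [exponent_lt_one hγ])
  have h7 : (1 + d) ^ γ⁻¹ = (1 + d) ^ (-((γ - 1) / γ)) * (1 + d) := by
    nth_rw 3 [← Real.rpow_one (1 + d)]
    rw [← Real.rpow_add hd', exponent_eq hγ]
    congr 1
    ring
  have h8 : 0 < (1 + d) ^ (-((γ - 1) / γ)) := Real.rpow_pos_of_pos hd' _
  rw [h7] at h5
  refine le_of_mul_le_mul_left ?_ h8
  have h9 := mul_le_mul_of_nonneg_left h6 (sub_nonneg.2 hcd)
  linarith

lemma ratio_comparison_left (hγ : 1 < γ) {η : ℝ} (hη : 0 < η) :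
    ∃ ε > 0, ∀ c d x y : ℝ, -1 ≤ c → c < d → d ≤ 0 → c ≤ x → x ≤ y → y ≤ d →
      hgam γ d - hgam γ c ≤ ε * (hgam γ c + 1) →
      |(y - x) / (d - c) - (hgam γ y - hgam γ x) / (hgam γ d - hgam γ c)| ≤ η := by
  refine ⟨η / (2 * γ * (1 + η)), by positivity, ?_⟩
  intro c d x y hc hcd hd hcx hxy hyd h
  have hpos : 0 < hgam γ d - hgam γ c := sub_pos.2
    (strictMonoOn_hgam hγ ⟨hc, by linarith⟩ ⟨by linarith, by linarith⟩ hcd)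
  have hc1 : -1 < c := by
    refine lt_of_le_of_ne hc ?_
    rintro rfl
    rw [hgam_neg_one] at h hpos
    linarith
  have h1 := sub_le_of_hgam_sub_le hγ hc1 hcd.le hd (by positivity) h
  have h2 : (1 + d) / (1 + c) ≤ 1 + η := by
    rw [div_le_iff₀ (by linarith)]
    rw [show 2 * γ * (η / (2 * γ * (1 + η))) * (1 + d) = η * (1 + d) / (1 + η) by field_simp,
      le_div_iff₀ (by linarith)] at h1
    linarith
  have h3 : singDensity γ c ≤ singDensity γ d * (1 + η) :=
    (singDensity_le_mul_div hγ hc1 hcd.le hd).trans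
      (mul_le_mul_of_nonneg_left h2 (singDensity_nonneg ⟨by linarith, by linarith⟩))
  obtain ⟨h4, h5⟩ := hgam_sub_bounds hγ hc1 hcx hxy hyd hd
  obtain ⟨h6, h7⟩ := hgam_sub_bounds hγ hc1 le_rfl hcd.le le_rfl hd
  have hn := singNorm_pos hγ
  set a := hgam γ y - hgam γ x
  set b := hgam γ d - hgam γ c
  have hA : 0 ≤ y - x := by linarith
  have hB : 0 < d - c := by linarith
  have hAB : (y - x) / (d - c) ≤ 1 := (div_le_one hB).2 (by linarith)
  have hab : a / b ≤ 1 := by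
    refine (div_le_one hpos).2 ?_
    have m := (strictMonoOn_hgam hγ).monotoneOn
    have m1 := m (a := y) (b := d) ⟨by linarith, by linarith⟩ ⟨by linarith, by linarith⟩ hyd
    have m2 := m (a := c) (b := x) ⟨by linarith, by linarith⟩ ⟨by linarith, by linarith⟩ hcx
    simp only [a, b]
    linarith
  have k1 : (y - x) / (d - c) ≤ (1 + η) * (a / b) := by
    rw [← mul_div_assoc, div_le_div_iff₀ hB hpos]
    calc (y - x) * b ≤ (y - x) * (singNorm γ * ((d - c) * (singDensity γ d * (1 + η)))) := by
          refine mul_le_mul_of_nonneg_left (h7.trans ?_) hA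
          gcongr
      _ = (1 + η) * (singNorm γ * ((y - x) * singDensity γ d)) * (d - c) := by ring
      _ ≤ _ := by gcongr
  have k2 : a / b ≤ (1 + η) * ((y - x) / (d - c)) := by
    rw [← mul_div_assoc, div_le_div_iff₀ hpos hB]
    calc a * (d - c) ≤ (singNorm γ * ((y - x) * (singDensity γ d * (1 + η)))) * (d - c) := by
          refine mul_le_mul_of_nonneg_right (h5.trans ?_) hB.le
          gcongr
      _ = (1 + η) * (y - x) * (singNorm γ * ((d - c) * singDensity γ d)) := by ring
      _ ≤ _ := by gcongr
  rw [abs_le]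
  constructor <;> nlinarith

lemma ratio_comparison (hγ : 1 < γ) {η : ℝ} (hη : 0 < η) :
    ∃ ε > 0, ∀ c d x y : ℝ, x ∈ uIcc c d → y ∈ uIcc c d → c ≠ d →
      (c ∈ Icc (-1) 0 ∧ d ∈ Icc (-1) 0 ∧ |hgam γ c - hgam γ d| ≤ ε * |hgam γ c + 1| ∧
          |hgam γ c - hgam γ d| ≤ ε * |hgam γ d + 1| ∨
        c ∈ Icc 0 1 ∧ d ∈ Icc 0 1 ∧ |hgam γ c - hgam γ d| ≤ ε * |hgam γ c - 1| ∧
          |hgam γ c - hgam γ d| ≤ ε * |hgam γ d - 1|) →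
      |(|x - y| / |c - d|) - (|hgam γ x - hgam γ y| / |hgam γ c - hgam γ d|)| ≤ η := by
  obtain ⟨ε, hε, H⟩ := ratio_comparison_left hγ hη
  refine ⟨ε, hε, ?_⟩
  have m := (strictMonoOn_hgam hγ).monotoneOn
  have key : ∀ c d x y : ℝ, x ∈ uIcc c d → y ∈ uIcc c d → c ≠ d →
      c ∈ Icc (-1:ℝ) 0 → d ∈ Icc (-1:ℝ) 0 → |hgam γ c - hgam γ d| ≤ ε * |hgam γ c + 1| →
      |hgam γ c - hgam γ d| ≤ ε * |hgam γ d + 1| →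
      |(|x - y| / |c - d|) - (|hgam γ x - hgam γ y| / |hgam γ c - hgam γ d|)| ≤ η := by
    intro c d x y hx hy hcd hc hd h1 h2
    wlog h : c < d generalizing c d
    · rw [abs_sub_comm c d, abs_sub_comm (hgam γ c)]
      rw [abs_sub_comm (hgam γ c)] at h1 h2
      rw [uIcc_comm] at hx hy
      exact this d c hx hy hcd.symm hd hc h2 h1 (lt_of_le_of_ne (not_lt.1 h) hcd.symm)
    wlog hxy : x ≤ y generalizing x y
    · rw [abs_sub_comm x y, abs_sub_comm (hgam γ x)]
      exact this y x hy hx (le_of_not_ge hxy)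
    rw [uIcc_of_le h.le] at hx hy
    have mem : ∀ {t}, t ∈ Icc c d → t ∈ Icc (-1:ℝ) 1 := fun ht =>
      ⟨by linarith [ht.1, hc.1], by linarith [ht.2, hd.2]⟩
    have m1 := m (mem hx) (mem hy) hxy
    have m2 := m (mem (left_mem_Icc.2 h.le)) (mem (right_mem_Icc.2 h.le)) h.le
    have m3 := m (a := -1) (by simp) (mem (left_mem_Icc.2 h.le)) hc.1
    rw [hgam_neg_one] at m3
    rw [abs_sub_comm x y, abs_sub_comm (hgam γ x), abs_sub_comm c, abs_sub_comm (hgam γ c),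
      abs_of_nonneg (sub_nonneg.2 hxy), abs_of_nonneg (sub_nonneg.2 h.le),
      abs_of_nonneg (sub_nonneg.2 m1), abs_of_nonneg (sub_nonneg.2 m2)]
    rw [abs_sub_comm, abs_of_nonneg (sub_nonneg.2 m2),
      abs_of_nonneg (by linarith)] at h1
    exact H c d x y hc.1 h hd.2 hx.1 hxy hy.2 h1
  rintro c d x y hx hy hcd (⟨hc, hd, h1, h2⟩ | ⟨hc, hd, h1, h2⟩)
  · exact key c d x y hx hy hcd hc hd h1 h2
  · have mem : ∀ {t}, t ∈ uIcc c d → t ∈ Icc (-1:ℝ) 1 := fun ht =>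
      uIcc_subset_Icc ⟨by linarith [hc.1], hc.2⟩ ⟨by linarith [hd.1], hd.2⟩ ht
    have e : ∀ u v : ℝ, |-u - -v| = |u - v| := fun u v => by
      rw [← neg_sub', abs_neg]
    have e1 : ∀ u : ℝ, |-u + 1| = |u - 1| := fun u => by
      rw [← abs_neg (u - 1)]; ring_nf
    have n : ∀ {u}, u ∈ uIcc c d → -u ∈ uIcc (-c) (-d) := fun hu => by
      rw [mem_uIcc] at hu ⊢
      rcases hu with hu | hu
      · exact Or.inr ⟨by linarith, by linarith⟩
      · exact Or.inl ⟨by linarith, by linarith⟩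
    have := key (-c) (-d) (-x) (-y) (n hx) (n hy) (by simpa using hcd)
      ⟨by linarith [hc.2], by linarith [hc.1]⟩ ⟨by linarith [hd.2], by linarith [hd.1]⟩
    rw [hgam_neg hγ (mem hx), hgam_neg hγ (mem hy), hgam_neg hγ (mem left_mem_uIcc),
      hgam_neg hγ (mem right_mem_uIcc)] at this
    simp only [e, e1] at this
    exact this h1 h2

lemma exists_tendsto_div_hgam_rpow (hγ : 1 < γ) :
    ∃ c > 0, Tendsto (fun x => (1 + x) / (hgam γ x + 1) ^ γ) (𝓝[>] (-1)) (𝓝 c) := by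
  have hγ0 : 0 < γ := by linarith
  have hn := singNorm_pos hγ
  set l : ℝ := singNorm γ * (γ * 2 ^ (-((γ - 1) / γ))) with hl
  have hl0 : 0 < l := by positivity
  have hm : (-1:ℝ) ∈ Icc (-1:ℝ) 1 := by simp
  have hev : ∀ᶠ x : ℝ in 𝓝[>] (-1), x ∈ Ioo (-1:ℝ) 0 := Ioo_mem_nhdsGT (by norm_num)
  have bounds : ∀ x ∈ Ioo (-1:ℝ) 0, l ≤ (hgam γ x + 1) / (1 + x) ^ γ⁻¹ ∧
      (hgam γ x + 1) / (1 + x) ^ γ⁻¹ ≤ singNorm γ * (γ * (1 - x) ^ (-((γ - 1) / γ))) := by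
    intro x hx
    have hx' : x ∈ Icc (-1:ℝ) 1 := ⟨hx.1.le, by linarith [hx.2]⟩
    have hp : 0 < (1 + x) ^ γ⁻¹ := Real.rpow_pos_of_pos (by linarith [hx.1]) _
    have hi := intervalIntegrable_singDensity hγ hm hx'
    have hj := fun c : ℝ => (intervalIntegrable_left hγ (-1) x).mul_const c
    have hI : ∀ c : ℝ, ∫ t in (-1:ℝ)..x, (1 + t) ^ (-((γ - 1) / γ)) * c =
        γ * (1 + x) ^ γ⁻¹ * c := fun c => by
      rw [intervalIntegral.integral_mul_const, integral_left hγ]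
      simp [Real.zero_rpow (inv_pos.2 hγ0).ne']
    have h := hgam_sub hγ hm hx'
    rw [hgam_neg_one, sub_neg_eq_add] at h
    have hβ := exponent_pos hγ
    rw [h]
    constructor
    · rw [le_div_iff₀ hp, hl]
      have := intervalIntegral.integral_mono_on hx.1.le (hj (2 ^ (-((γ - 1) / γ)))) hi
        (fun t ht => by
          rw [singDensity_eq ⟨ht.1, by linarith [ht.2, hx.2]⟩]
          refine mul_le_mul_of_nonneg_left ?_ (Real.rpow_nonneg (by linarith [ht.1]) _)
          exact Real.rpow_le_rpow_of_nonpos (by linarith [ht.2, hx.2]) (by linarith [ht.1])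
            (by linarith))
      rw [hI] at this
      calc _ = singNorm γ * (γ * (1 + x) ^ γ⁻¹ * 2 ^ (-((γ - 1) / γ))) := by ring
        _ ≤ _ := mul_le_mul_of_nonneg_left this hn.le
    · rw [div_le_iff₀ hp]
      have := intervalIntegral.integral_mono_on hx.1.le hi (hj ((1 - x) ^ (-((γ - 1) / γ))))
        (fun t ht => by
          rw [singDensity_eq ⟨ht.1, by linarith [ht.2, hx.2]⟩]
          refine mul_le_mul_of_nonneg_left ?_ (Real.rpow_nonneg (by linarith [ht.1]) _)
          exact Real.rpow_le_rpow_of_nonpos (by linarith [hx.2]) (by linarith [ht.2])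
            (by linarith))
      rw [hI] at this
      calc _ ≤ singNorm γ * (γ * (1 + x) ^ γ⁻¹ * (1 - x) ^ (-((γ - 1) / γ))) :=
            mul_le_mul_of_nonneg_left this hn.le
        _ = _ := by ring
  have hup : Tendsto (fun x : ℝ => singNorm γ * (γ * (1 - x) ^ (-((γ - 1) / γ)))) (𝓝[>] (-1))
      (𝓝 l) := by
    have : ContinuousAt (fun x : ℝ => singNorm γ * (γ * (1 - x) ^ (-((γ - 1) / γ)))) (-1) := by
      refine continuousAt_const.mul (continuousAt_const.mul ?_)
      exact (continuousAt_const.sub continuousAt_id).rpow_const (Or.inl (by norm_num))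
    have h := this.tendsto.mono_left (nhdsWithin_le_nhds (s := Ioi (-1:ℝ)))
    rwa [show (1:ℝ) - -1 = 2 by norm_num] at h
  have hlim : Tendsto (fun x => (hgam γ x + 1) / (1 + x) ^ γ⁻¹) (𝓝[>] (-1)) (𝓝 l) :=
    tendsto_of_tendsto_of_tendsto_of_le_of_le' tendsto_const_nhds hup
      (hev.mono fun x hx => (bounds x hx).1) (hev.mono fun x hx => (bounds x hx).2)
  refine ⟨(l ^ γ)⁻¹, by positivity, ?_⟩
  refine ((hlim.rpow_const (p := γ) (Or.inl hl0.ne')).inv₀ (by positivity)).congr' ?_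
  filter_upwards [hev] with x hx
  have h1 : 0 ≤ 1 + x := by linarith [hx.1]
  have h2 : 0 ≤ hgam γ x + 1 := by
    have := (strictMonoOn_hgam hγ).monotoneOn hm ⟨hx.1.le, by linarith [hx.2]⟩ hx.1.le
    rw [hgam_neg_one] at this
    linarith
  rw [Real.div_rpow h2 (Real.rpow_nonneg h1 _), ← Real.rpow_mul h1, inv_mul_cancel₀ hγ0.ne',
    Real.rpow_one, inv_div]

end SingularMetric

/-- The monotonicity interval on which the branch labelled `b` takes its values. -/
def branchSet : Bool → Set ℝ
  | false => Icc (-1) 0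
  | true => Icc 0 1

lemma branchSet_subset (b : Bool) : branchSet b ⊆ Icc (-1:ℝ) 1 := by
  cases b
  · exact Icc_subset_Icc_right (by norm_num)
  · exact Icc_subset_Icc_left (by norm_num)

lemma ordConnected_branchSet (b : Bool) : (branchSet b).OrdConnected := by
  cases b <;> exact ordConnected_Icc

/-- A unimodal full folding map of `[-1,1]` with turning point `0`. -/
structure IsFolding (F : ℝ → ℝ) : Prop where
  continuousOn : ∀ b, ContinuousOn F (branchSet b)
  mono : StrictMonoOn F (Icc (-1) 0)
  anti : StrictAntiOn F (Icc 0 1)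
  map_neg_one : F (-1) = -1
  map_zero : F 0 = 1
  map_one : F 1 = -1

namespace IsFolding

variable {F : ℝ → ℝ}

lemma injOn (hF : IsFolding F) (b : Bool) : InjOn F (branchSet b) := by
  cases b
  · exact hF.mono.injOn
  · exact hF.anti.injOn

lemma mapsTo (hF : IsFolding F) {b : Bool} {x y z : ℝ} (hx : x ∈ branchSet b)
    (hy : y ∈ branchSet b) (hz : z ∈ uIcc x y) : F z ∈ uIcc (F x) (F y) := by
  have hsub : uIcc x y ⊆ branchSet b := (ordConnected_branchSet b).uIcc_subset hx hy
  cases b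
  · exact (hF.mono.monotoneOn.mono hsub).mapsTo_uIcc hz
  · exact (hF.anti.antitoneOn.mono hsub).mapsTo_uIcc hz

lemma branch_spec (hF : IsFolding F) (b : Bool) {y : ℝ} (hy : y ∈ Icc (-1:ℝ) 1) :
    branch F b y ∈ branchSet b ∧ F (branch F b y) = y := by
  cases b
  · have h : ∃ a ∈ Icc (-1:ℝ) 0, F a = y := by
      have := intermediate_value_Icc (by norm_num) (hF.continuousOn false)
      rw [hF.map_neg_one, hF.map_zero] at this
      exact this hy
    exact ⟨Function.invFunOn_mem h, Function.invFunOn_eq h⟩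
  · have h : ∃ a ∈ Icc (0:ℝ) 1, F a = y := by
      have := intermediate_value_Icc' (by norm_num) (hF.continuousOn true)
      rw [hF.map_zero, hF.map_one] at this
      exact this hy
    exact ⟨Function.invFunOn_mem h, Function.invFunOn_eq h⟩

lemma branch_mem (hF : IsFolding F) (b : Bool) {y : ℝ} (hy : y ∈ Icc (-1:ℝ) 1) :
    branch F b y ∈ branchSet b := (hF.branch_spec b hy).1

lemma map_branch (hF : IsFolding F) (b : Bool) {y : ℝ} (hy : y ∈ Icc (-1:ℝ) 1) :
    F (branch F b y) = y := (hF.branch_spec b hy).2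

lemma maps_branchSet (hF : IsFolding F) {b : Bool} {x : ℝ} (hx : x ∈ branchSet b) :
    F x ∈ Icc (-1:ℝ) 1 := by
  have h0 : (0:ℝ) ∈ branchSet b := by cases b <;> simp [branchSet]
  cases b
  · have := hF.mapsTo (b := false) (x := -1) (y := 0) (by simp [branchSet]) h0
      (by rw [uIcc_of_le (by norm_num)]; exact hx)
    rwa [hF.map_zero, hF.map_neg_one, uIcc_of_le (by norm_num)] at this
  · have := hF.mapsTo (b := true) (x := 1) (y := 0) (by simp [branchSet]) h0
      (by rw [uIcc_of_ge (by norm_num)]; exact hx)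
    rwa [hF.map_zero, hF.map_one, uIcc_of_le (by norm_num)] at this

lemma branch_map (hF : IsFolding F) {b : Bool} {x : ℝ} (hx : x ∈ branchSet b) :
    branch F b (F x) = x :=
  hF.injOn b (hF.branch_mem b (hF.maps_branchSet hx)) hx
    (hF.map_branch b (hF.maps_branchSet hx))

lemma branch_false_neg_one (hF : IsFolding F) : branch F false (-1) = -1 := by
  conv_lhs => rw [← hF.map_neg_one]
  exact hF.branch_map (by simp [branchSet])

lemma branch_true_neg_one (hF : IsFolding F) : branch F true (-1) = 1 := by
  conv_lhs => rw [← hF.map_one]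
  exact hF.branch_map (by simp [branchSet])

lemma branch_one (hF : IsFolding F) (b : Bool) : branch F b 1 = 0 := by
  conv_lhs => rw [← hF.map_zero]
  exact hF.branch_map (by cases b <;> simp [branchSet])

lemma branch_injOn (hF : IsFolding F) (b : Bool) : InjOn (branch F b) (Icc (-1) 1) := by
  intro x hx y hy h
  rw [← hF.map_branch b hx, h, hF.map_branch b hy]

lemma branch_false_strictMonoOn (hF : IsFolding F) :
    StrictMonoOn (branch F false) (Icc (-1) 1) := by
  intro x hx y hy h
  rw [← hF.mono.lt_iff_lt (hF.branch_mem false hx) (hF.branch_mem false hy)]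
  rwa [hF.map_branch false hx, hF.map_branch false hy]

lemma branch_true_strictAntiOn (hF : IsFolding F) :
    StrictAntiOn (branch F true) (Icc (-1) 1) := by
  intro x hx y hy h
  rw [← hF.anti.lt_iff_gt (hF.branch_mem true hx) (hF.branch_mem true hy)]
  rwa [hF.map_branch true hx, hF.map_branch true hy]

lemma image_branch_uIcc (hF : IsFolding F) (b : Bool) {x y : ℝ} (hx : x ∈ Icc (-1:ℝ) 1)
    (hy : y ∈ Icc (-1:ℝ) 1) :
    branch F b '' uIcc x y = uIcc (branch F b x) (branch F b y) := by
  have hsub : uIcc x y ⊆ Icc (-1:ℝ) 1 := uIcc_subset_Icc hx hy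
  refine Subset.antisymm ?_ fun z hz => ?_
  · cases b
    · exact (hF.branch_false_strictMonoOn.monotoneOn.mono hsub).image_uIcc_subset
    · exact (hF.branch_true_strictAntiOn.antitoneOn.mono hsub).image_uIcc_subset
  · have hbx := hF.branch_mem b hx
    have hby := hF.branch_mem b hy
    have h := hF.mapsTo hbx hby hz
    rw [hF.map_branch b hx, hF.map_branch b hy] at h
    exact ⟨F z, h, hF.branch_map ((ordConnected_branchSet b).uIcc_subset hbx hby hz)⟩

lemma gw_mem (hF : IsFolding F) (w : List Bool) {x : ℝ} (hx : x ∈ Icc (-1:ℝ) 1) :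
    gw F w x ∈ Icc (-1:ℝ) 1 := by
  induction w with
  | nil => exact hx
  | cons b w ih => exact branchSet_subset b (hF.branch_mem b ih)

lemma gw_injOn (hF : IsFolding F) (w : List Bool) : InjOn (gw F w) (Icc (-1) 1) := by
  induction w with
  | nil => exact injOn_id _
  | cons b w ih => exact (hF.branch_injOn b).comp ih fun x hx => hF.gw_mem w hx

lemma gw_append (F : ℝ → ℝ) (u w : List Bool) (x : ℝ) : gw F (u ++ w) x = gw F u (gw F w x) := by
  induction u with
  | nil => rfl
  | cons b u ih => simp only [List.cons_append, gw, Function.comp, ih]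

lemma image_gw_uIcc (hF : IsFolding F) (w : List Bool) {x y : ℝ} (hx : x ∈ Icc (-1:ℝ) 1)
    (hy : y ∈ Icc (-1:ℝ) 1) : gw F w '' uIcc x y = uIcc (gw F w x) (gw F w y) := by
  induction w with
  | nil => simp [gw]
  | cons b w ih =>
    simp only [gw, image_comp, ih]
    exact hF.image_branch_uIcc b (hF.gw_mem w hx) (hF.gw_mem w hy)

lemma gw_mem_uIcc (hF : IsFolding F) (w : List Bool) {x : ℝ} (hx : x ∈ Icc (-1:ℝ) 1) :
    gw F w x ∈ uIcc (gw F w (-1)) (gw F w 1) := by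
  rw [← hF.image_gw_uIcc w (by simp) (by simp), uIcc_of_le (by norm_num)]
  exact mem_image_of_mem _ hx

lemma len_image_gw (hF : IsFolding F) (w : List Bool) {x y : ℝ} (hx : x ∈ Icc (-1:ℝ) 1)
    (hy : y ∈ Icc (-1:ℝ) 1) : len (gw F w '' uIcc x y) = |gw F w x - gw F w y| := by
  rw [hF.image_gw_uIcc w hx hy, len, Real.volume_interval, ENNReal.toReal_ofReal (abs_nonneg _),
    abs_sub_comm]

lemma len_Iw (hF : IsFolding F) (w : List Bool) :
    len (Iw F w) = |gw F w (-1) - gw F w 1| := by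
  rw [← hF.len_image_gw w (by simp) (by simp), uIcc_of_le (by norm_num), Iw]

lemma abs_gw_sub_le (hF : IsFolding F) (w : List Bool) {x y : ℝ} (hx : x ∈ Icc (-1:ℝ) 1)
    (hy : y ∈ Icc (-1:ℝ) 1) : |gw F w x - gw F w y| ≤ len (Iw F w) := by
  rw [hF.len_Iw]
  rw [abs_sub_comm, abs_sub_comm (gw F w (-1))]
  exact abs_sub_le_of_uIcc_subset_uIcc
    (uIcc_subset_uIcc (hF.gw_mem_uIcc w hx) (hF.gw_mem_uIcc w hy))

lemma gw_ne (hF : IsFolding F) (w : List Bool) {x y : ℝ} (hx : x ∈ Icc (-1:ℝ) 1)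
    (hy : y ∈ Icc (-1:ℝ) 1) (h : x ≠ y) : 0 < |gw F w x - gw F w y| :=
  abs_pos.2 (sub_ne_zero.2 fun e => h (hF.gw_injOn w hx hy e))

lemma gw_replicate_neg_one (hF : IsFolding F) (m : ℕ) :
    gw F (List.replicate m false) (-1) = -1 := by
  induction m with
  | zero => rfl
  | succ m ih => simp only [List.replicate_succ, gw, Function.comp, ih, hF.branch_false_neg_one]

lemma gw_replicate_strictMonoOn (hF : IsFolding F) (m : ℕ) :
    StrictMonoOn (gw F (List.replicate m false)) (Icc (-1) 1) := by
  induction m with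
  | zero => exact strictMonoOn_id
  | succ m ih => exact hF.branch_false_strictMonoOn.comp ih fun x hx => hF.gw_mem _ hx

end IsFolding

section Words

/-- The word `aₙ ⋯ a₁` of length `n`. -/
def stem (a : ℕ → Bool) : ℕ → List Bool
  | 0 => []
  | n + 1 => a (n + 1) :: stem a n

lemma word_eq (a : ℕ → Bool) (n : ℕ) : word a n = stem a n ++ [a 0] := by
  induction n with
  | zero => simp [word, stem]
  | succ n ih =>
    rw [word, List.range_succ, List.reverse_append]
    simp only [List.reverse_cons, List.reverse_nil, List.nil_append, List.cons_append,
      List.map_cons, stem]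
    exact congrArg _ ih

lemma length_stem (a : ℕ → Bool) (n : ℕ) : (stem a n).length = n := by
  induction n with
  | zero => rfl
  | succ n ih => simp [stem, ih]

lemma stem_congr {a b : ℕ → Bool} {n : ℕ} (h : ∀ k ≤ n, a k = b k) : stem a n = stem b n := by
  induction n with
  | zero => rfl
  | succ n ih => rw [stem, stem, ih fun k hk => h k (by omega), h _ le_rfl]

lemma stem_add_of_zero {a : ℕ → Bool} {n : ℕ} (m : ℕ)
    (h : ∀ k, n < k → k ≤ n + m → a k = false) :
    stem a (n + m) = List.replicate m false ++ stem a n := by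
  induction m with
  | zero => rfl
  | succ m ih =>
    rw [← add_assoc, stem, ih fun k h1 h2 => h k h1 (by omega), h _ (by omega) (by omega)]
    rfl

/-- The endpoint of the interval `I_b` that is not the turning point. -/
def outerEnd : Bool → ℝ
  | false => -1
  | true => 1

lemma outerEnd_mem (b : Bool) : outerEnd b ∈ Icc (-1:ℝ) 1 := by cases b <;> simp [outerEnd]

lemma outerEnd_ne_zero (b : Bool) : outerEnd b ≠ 0 := by cases b <;> simp [outerEnd]

lemma IsFolding.ratio_eq {F : ℝ → ℝ} (hF : IsFolding F) (a : ℕ → Bool) (n : ℕ) :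
    ratio F a n = |gw F (stem a n) (outerEnd (a 0)) - gw F (stem a n) 0| /
      |gw F (stem a n) (-1) - gw F (stem a n) 1| := by
  have h0 : (0:ℝ) ∈ Icc (-1:ℝ) 1 := by simp
  rw [ratio, word_eq, List.dropLast_concat, hF.len_Iw, hF.len_Iw, IsFolding.gw_append,
    IsFolding.gw_append]
  have h1 : gw F [a 0] (-1) = outerEnd (a 0) := by
    cases a 0
    · exact hF.branch_false_neg_one
    · exact hF.branch_true_neg_one
  have h2 : gw F [a 0] 1 = 0 := hF.branch_one _
  rw [h1, h2]

end Words

section Distortion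

lemma abs_log_sub_log_le_div {m s t : ℝ} (hm : 0 < m) (hs : m ≤ s) (ht : m ≤ t) :
    |Real.log s - Real.log t| ≤ |s - t| / m := by
  have key : ∀ {s t : ℝ}, m ≤ s → m ≤ t → Real.log s - Real.log t ≤ |s - t| / m := by
    intro s t hs ht
    have ht0 : 0 < t := hm.trans_le ht
    rw [← Real.log_div (hm.trans_le hs).ne' ht0.ne']
    calc Real.log (s / t) ≤ s / t - 1 := Real.log_le_sub_one_of_pos (div_pos (hm.trans_le hs) ht0)
      _ = (s - t) / t := by field_simp
      _ ≤ |s - t| / t := by gcongr; exact le_abs_self _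
      _ ≤ |s - t| / m := by gcongr
  rw [abs_le]
  constructor
  · have := key ht hs
    rw [abs_sub_comm] at this
    linarith
  · exact key hs ht

lemma continuousOn_of_abs_sub_le_rpow {d : ℝ → ℝ} {s : Set ℝ} {K α : ℝ} (hα : 0 < α)
    (h : ∀ x ∈ s, ∀ y ∈ s, |d x - d y| ≤ K * |x - y| ^ α) : ContinuousOn d s := by
  intro x hx
  have h1 : Tendsto (fun y => K * |y - x| ^ α) (𝓝[s] x) (𝓝 0) := by
    have : ContinuousAt (fun y => K * |y - x| ^ α) x :=
      continuousAt_const.mul (((continuous_id.sub continuous_const).abs.continuousAt).rpow_const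
        (Or.inr hα.le))
    have h := this.tendsto.mono_left (nhdsWithin_le_nhds (s := s))
    simpa [Real.zero_rpow hα.ne'] using h
  refine tendsto_iff_dist_tendsto_zero.2
    (squeeze_zero' (Eventually.of_forall fun _ => dist_nonneg) ?_ h1)
  filter_upwards [self_mem_nhdsWithin] with y hy
  exact h y hy x hx

lemma exists_abs_sub_eq_mul {F d : ℝ → ℝ} {p q : ℝ}
    (hd : ∀ x ∈ Icc p q, HasDerivWithinAt F (d x) (Icc p q) x) {x y : ℝ} (hx : x ∈ Icc p q)
    (hy : y ∈ Icc p q) (hxy : x ≠ y) : ∃ ξ ∈ uIcc x y, |F x - F y| = |d ξ| * |x - y| := by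
  wlog h : x < y generalizing x y
  · obtain ⟨ξ, h1, h2⟩ := this hy hx hxy.symm (lt_of_le_of_ne (not_lt.1 h) hxy.symm)
    rw [uIcc_comm, abs_sub_comm, abs_sub_comm x]
    exact ⟨ξ, h1, h2⟩
  have hsub : Icc x y ⊆ Icc p q := Icc_subset_Icc hx.1 hy.2
  obtain ⟨ξ, h1, h2⟩ := exists_hasDerivAt_eq_slope F d h
    (fun t ht => ((hd t (hsub ht)).continuousWithinAt).mono hsub)
    (fun t ht => (hd t (hsub (Ioo_subset_Icc_self ht))).hasDerivAt
      (Icc_mem_nhds (hx.1.trans_lt ht.1) (ht.2.trans_le hy.2)))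
  refine ⟨ξ, Icc_subset_uIcc (Ioo_subset_Icc_self h1), ?_⟩
  have : F y - F x = d ξ * (y - x) := by
    rw [h2, div_mul_cancel₀ _ (sub_ne_zero.2 h.ne')]
  rw [abs_sub_comm, this, abs_mul, abs_sub_comm x]

/-- The logarithm of the ratio of the lengths of the images under `g_w` of the intervals with
endpoints `x, y` and `u, v`. -/
noncomputable def logRatio (F : ℝ → ℝ) (w : List Bool) (x y u v : ℝ) : ℝ :=
  Real.log (|gw F w x - gw F w y| / |gw F w u - gw F w v|)

/-- A folding map whose logarithmic distortion along the inverse branches is summable. -/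
structure HasSummableDistortion (F : ℝ → ℝ) (C lam : ℝ) : Prop extends IsFolding F where
  C_pos : 0 < C
  lam_mem : lam ∈ Ioo (0:ℝ) 1
  len_le : ∀ w : List Bool, len (Iw F w) ≤ C * lam ^ w.length
  distortion : ∀ (w : List Bool) (b : Bool) (x y u v : ℝ), x ∈ Icc (-1:ℝ) 1 → y ∈ Icc (-1:ℝ) 1 →
    u ∈ Icc (-1:ℝ) 1 → v ∈ Icc (-1:ℝ) 1 → x ≠ y → u ≠ v →
    |logRatio F (b :: w) x y u v - logRatio F w x y u v| ≤ C * lam ^ w.length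

lemma IsFolding.distortion_le {F : ℝ → ℝ} (hF : IsFolding F) {d : ℝ → ℝ} {b : Bool} {m K α : ℝ}
    (hα : 0 < α) (hK : 0 < K) (hm : 0 < m)
    (hd : ∀ x ∈ branchSet b, HasDerivWithinAt F (d x) (branchSet b) x)
    (hmd : ∀ x ∈ branchSet b, m ≤ |d x|)
    (hH : ∀ x ∈ branchSet b, ∀ y ∈ branchSet b, |d x - d y| ≤ K * |x - y| ^ α)
    (w : List Bool) {x y u v : ℝ} (hx : x ∈ Icc (-1:ℝ) 1) (hy : y ∈ Icc (-1:ℝ) 1)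
    (hu : u ∈ Icc (-1:ℝ) 1) (hv : v ∈ Icc (-1:ℝ) 1) (hxy : x ≠ y) (huv : u ≠ v) :
    |logRatio F (b :: w) x y u v - logRatio F w x y u v| ≤
      K / m * len (Iw F (b :: w)) ^ α := by
  have slope : ∀ {x y : ℝ}, x ∈ Icc (-1:ℝ) 1 → y ∈ Icc (-1:ℝ) 1 → x ≠ y →
      ∃ ξ ∈ uIcc (gw F (b :: w) (-1)) (gw F (b :: w) 1), ξ ∈ branchSet b ∧
        |gw F w x - gw F w y| = |d ξ| * |gw F (b :: w) x - gw F (b :: w) y| := by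
    intro x y hx hy hxy
    have h1 := hF.branch_mem b (hF.gw_mem w hx)
    have h2 := hF.branch_mem b (hF.gw_mem w hy)
    have hne : gw F (b :: w) x ≠ gw F (b :: w) y := fun e =>
      hxy (hF.gw_injOn (b :: w) hx hy e)
    have : ∃ ξ ∈ uIcc (gw F (b :: w) x) (gw F (b :: w) y),
        |F (gw F (b :: w) x) - F (gw F (b :: w) y)| =
          |d ξ| * |gw F (b :: w) x - gw F (b :: w) y| := by
      cases b
      · exact exists_abs_sub_eq_mul hd h1 h2 hne
      · exact exists_abs_sub_eq_mul hd h1 h2 hne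
    obtain ⟨ξ, hξ, h⟩ := this
    refine ⟨ξ, uIcc_subset_uIcc (hF.gw_mem_uIcc _ hx) (hF.gw_mem_uIcc _ hy) hξ,
      (ordConnected_branchSet b).uIcc_subset h1 h2 hξ, ?_⟩
    rw [← h]
    simp only [gw, Function.comp]
    rw [hF.map_branch b (hF.gw_mem w hx), hF.map_branch b (hF.gw_mem w hy)]
  obtain ⟨ξ, hξ, hξb, h1⟩ := slope hx hy hxy
  obtain ⟨ζ, hζ, hζb, h2⟩ := slope hu hv huv
  have p1 := hF.gw_ne (b :: w) hx hy hxy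
  have p2 := hF.gw_ne (b :: w) hu hv huv
  have q1 : 0 < |d ξ| := hm.trans_le (hmd ξ hξb)
  have q2 : 0 < |d ζ| := hm.trans_le (hmd ζ hζb)
  have e : logRatio F (b :: w) x y u v - logRatio F w x y u v =
      Real.log |d ζ| - Real.log |d ξ| := by
    rw [logRatio, logRatio, h1, h2, Real.log_div p1.ne' p2.ne',
      Real.log_div (mul_pos q1 p1).ne' (mul_pos q2 p2).ne', Real.log_mul q1.ne' p1.ne',
      Real.log_mul q2.ne' p2.ne']
    ring
  have hdist : |ζ - ξ| ≤ len (Iw F (b :: w)) := by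
    rw [hF.len_Iw, abs_sub_comm, abs_sub_comm (gw F (b :: w) (-1)), abs_sub_comm ξ]
    exact abs_sub_le_of_uIcc_subset_uIcc (uIcc_subset_uIcc hξ hζ)
  rw [e]
  calc |Real.log |d ζ| - Real.log (|d ξ|)| ≤ |(|d ζ| - |d ξ|)| / m :=
        abs_log_sub_log_le_div hm (hmd ζ hζb) (hmd ξ hξb)
    _ ≤ K * |ζ - ξ| ^ α / m := by
        gcongr
        exact (abs_abs_sub_abs_le _ _).trans (hH ζ hζb ξ hξb)
    _ ≤ K * len (Iw F (b :: w)) ^ α / m := by gcongr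
    _ = _ := by ring

lemma IsFolding.exists_hasSummableDistortion {F : ℝ → ℝ} (hF : IsFolding F) {d : Bool → ℝ → ℝ}
    {K α : ℝ} (hα : α ∈ Ioc (0:ℝ) 1) (hK : 0 < K)
    (hd : ∀ b, ∀ x ∈ branchSet b, HasDerivWithinAt F (d b x) (branchSet b) x)
    (hne : ∀ b, ∀ x ∈ branchSet b, d b x ≠ 0)
    (hH : ∀ b, ∀ x ∈ branchSet b, ∀ y ∈ branchSet b, |d b x - d b y| ≤ K * |x - y| ^ α)
    {C lam : ℝ} (hC : 0 < C) (hlam : lam ∈ Ioo (0:ℝ) 1)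
    (hdecay : ∀ w : List Bool, len (Iw F w) ≤ C * lam ^ w.length) :
    ∃ C' lam', HasSummableDistortion F C' lam' := by
  have hmin : ∀ b, ∃ m > 0, ∀ x ∈ branchSet b, m ≤ |d b x| := by
    intro b
    have hc : ContinuousOn (fun x => |d b x|) (branchSet b) :=
      (continuousOn_of_abs_sub_le_rpow hα.1 (hH b)).abs
    have hcomp : IsCompact (branchSet b) := by cases b <;> exact isCompact_Icc
    have h0 : (0:ℝ) ∈ branchSet b := by cases b <;> simp [branchSet]
    obtain ⟨z, hz, h⟩ := hcomp.exists_isMinOn ⟨0, h0⟩ hc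
    exact ⟨|d b z|, abs_pos.2 (hne b z hz), fun x hx => h hx⟩
  choose m hm hmd using hmin
  have hl : lam ^ α ∈ Ioo (0:ℝ) 1 :=
    ⟨Real.rpow_pos_of_pos hlam.1 _, Real.rpow_lt_one hlam.1.le hlam.2 hα.1⟩
  have hle : lam ≤ lam ^ α := by
    have := Real.rpow_le_rpow_of_exponent_ge hlam.1 hlam.2.le hα.2
    rwa [Real.rpow_one] at this
  set M := K / min (m false) (m true) * C ^ α with hM
  have hM0 : 0 < M := by
    have := lt_min (hm false) (hm true)
    have := Real.rpow_pos_of_pos hC α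
    positivity
  refine ⟨C + M, lam ^ α, hF, by positivity, hl, fun w => (hdecay w).trans ?_, ?_⟩
  · have := pow_le_pow_left₀ hlam.1.le hle w.length
    have h2 := pow_pos hl.1 w.length
    nlinarith
  · intro w b x y u v hx hy hu hv hxy huv
    refine (hF.distortion_le hα.1 hK (lt_min (hm false) (hm true)) (hd b)
      (fun x hx => le_trans ?_ (hmd b x hx)) (hH b) w hx hy hu hv hxy huv).trans ?_
    · cases b
      · exact min_le_left _ _
      · exact min_le_right _ _
    · have h1 : len (Iw F (b :: w)) ≤ C * lam ^ w.length := by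
        refine (hdecay _).trans (mul_le_mul_of_nonneg_left ?_ hC.le)
        exact pow_le_pow_of_le_one hlam.1.le hlam.2.le (by simp)
      have h2 : len (Iw F (b :: w)) ^ α ≤ C ^ α * (lam ^ α) ^ w.length := by
        refine (Real.rpow_le_rpow ENNReal.toReal_nonneg h1 hα.1.le).trans_eq ?_
        rw [Real.mul_rpow hC.le (pow_nonneg hlam.1.le _), ← Real.rpow_natCast,
          ← Real.rpow_mul hlam.1.le, mul_comm (w.length : ℝ), Real.rpow_mul hlam.1.le,
          Real.rpow_natCast]
      have h3 : 0 < K / min (m false) (m true) := div_pos hK (lt_min (hm false) (hm true))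
      calc _ ≤ K / min (m false) (m true) * (C ^ α * (lam ^ α) ^ w.length) := by gcongr
        _ = M * (lam ^ α) ^ w.length := by rw [hM]; ring
        _ ≤ _ := by
          refine mul_le_mul_of_nonneg_right (by linarith) (pow_nonneg hl.1.le _)

namespace HasSummableDistortion

variable {F : ℝ → ℝ} {C lam : ℝ}

lemma abs_logRatio_sub_le (h : HasSummableDistortion F C lam) (w : List Bool) {x y u v : ℝ}
    (hx : x ∈ Icc (-1:ℝ) 1) (hy : y ∈ Icc (-1:ℝ) 1) (hu : u ∈ Icc (-1:ℝ) 1)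
    (hv : v ∈ Icc (-1:ℝ) 1) (hxy : x ≠ y) (huv : u ≠ v) :
    |logRatio F w x y u v - Real.log (|x - y| / |u - v|)| ≤ C / (1 - lam) := by
  have hl := h.lam_mem
  have h1 : 0 < 1 - lam := by linarith [hl.2]
  have hC := h.C_pos
  suffices |logRatio F w x y u v - Real.log (|x - y| / |u - v|)| ≤
      C / (1 - lam) * (1 - lam ^ w.length) by
    refine this.trans (mul_le_of_le_one_right (by positivity) ?_)
    linarith [pow_pos hl.1 w.length]
  induction w with
  | nil => simp [logRatio, gw]
  | cons b w ih =>
    have h2 := h.distortion w b x y u v hx hy hu hv hxy huv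
    have h3 := (abs_sub_le _ _ _).trans (add_le_add h2 ih)
    refine h3.trans_eq ?_
    rw [List.length_cons, pow_succ]
    field_simp
    ring

/-- Iterated pullbacks distort ratios of lengths by a bounded factor. -/
lemma exists_div_le (h : HasSummableDistortion F C lam) : ∃ M > 0, ∀ (w : List Bool) (x y u v : ℝ),
    x ∈ Icc (-1:ℝ) 1 → y ∈ Icc (-1:ℝ) 1 → u ∈ Icc (-1:ℝ) 1 → v ∈ Icc (-1:ℝ) 1 →
    x ≠ y → u ≠ v →
    |gw F w x - gw F w y| / |gw F w u - gw F w v| ≤ M * (|x - y| / |u - v|) := by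
  refine ⟨Real.exp (C / (1 - lam)), Real.exp_pos _, ?_⟩
  intro w x y u v hx hy hu hv hxy huv
  have h1 := (abs_le.1 (h.abs_logRatio_sub_le w hx hy hu hv hxy huv)).2
  have p1 := div_pos (h.gw_ne w hx hy hxy) (h.gw_ne w hu hv huv)
  have p2 : 0 < |x - y| / |u - v| :=
    div_pos (abs_pos.2 (sub_ne_zero.2 hxy)) (abs_pos.2 (sub_ne_zero.2 huv))
  rw [← Real.exp_log p1, ← Real.exp_log p2, ← Real.exp_add]
  refine Real.exp_le_exp.2 ?_
  rw [logRatio] at h1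
  linarith

lemma exists_tendsto_of_step {l : ℕ → ℝ} (hlam : lam ∈ Ioo (0:ℝ) 1)
    (hstep : ∀ n, |Real.log (l (n + 1)) - Real.log (l n)| ≤ C * lam ^ n) (hpos : ∀ n, 0 < l n) :
    ∃ L > 0, Tendsto l atTop (𝓝 L) := by
  have hc := cauchySeq_of_le_geometric (f := fun n => Real.log (l n)) lam C hlam.2
    (fun n => by rw [dist_comm]; exact hstep n)
  obtain ⟨L, hL⟩ := cauchySeq_tendsto_of_complete hc
  refine ⟨Real.exp L, Real.exp_pos L, ?_⟩
  refine ((Real.continuous_exp.tendsto L).comp hL).congr fun n => ?_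
  exact Real.exp_log (hpos n)

lemma exists_tendsto_div (h : HasSummableDistortion F C lam) (w : ℕ → List Bool)
    (hw : ∀ n, ∃ b, w (n + 1) = b :: w n) (hlen : ∀ n, n ≤ (w n).length)
    {x y u v : ℝ} (hx : x ∈ Icc (-1:ℝ) 1) (hy : y ∈ Icc (-1:ℝ) 1) (hu : u ∈ Icc (-1:ℝ) 1)
    (hv : v ∈ Icc (-1:ℝ) 1) (hxy : x ≠ y) (huv : u ≠ v) :
    ∃ L > 0, Tendsto (fun n => |gw F (w n) x - gw F (w n) y| / |gw F (w n) u - gw F (w n) v|)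
      atTop (𝓝 L) := by
  refine exists_tendsto_of_step (C := C) h.lam_mem (fun n => ?_)
    (fun n => div_pos (h.gw_ne _ hx hy hxy) (h.gw_ne _ hu hv huv))
  obtain ⟨b, hb⟩ := hw n
  rw [hb]
  refine (h.distortion (w n) b x y u v hx hy hu hv hxy huv).trans ?_
  exact mul_le_mul_of_nonneg_left (pow_le_pow_of_le_one h.lam_mem.1.le h.lam_mem.2.le (hlen n))
    h.C_pos.le

lemma abs_sub_le_abs_log_sub {s t : ℝ} (hs : 0 < s) (hs1 : s ≤ 1) (ht : 0 < t) (ht1 : t ≤ 1) :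
    |s - t| ≤ |Real.log s - Real.log t| := by
  have key : ∀ {s t : ℝ}, 0 < s → s ≤ 1 → 0 < t → s - t ≤ |Real.log s - Real.log t| := by
    intro s t hs hs1 ht
    have h1 := Real.log_le_sub_one_of_pos (div_pos ht hs)
    rw [Real.log_div ht.ne' hs.ne'] at h1
    have h2 : s - t ≤ s * |Real.log s - Real.log t| := by
      have h3 : s * (1 - t / s) = s - t := by field_simp
      rw [← h3]
      exact mul_le_mul_of_nonneg_left (by linarith [le_abs_self (Real.log s - Real.log t)]) hs.le
    nlinarith [abs_nonneg (Real.log s - Real.log t)]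
  rw [abs_le]
  have h1 := key ht ht1 hs
  rw [abs_sub_comm] at h1
  exact ⟨by linarith, key hs hs1 ht⟩

lemma ratio_pos (h : HasSummableDistortion F C lam) (a : ℕ → Bool) (n : ℕ) : 0 < ratio F a n := by
  rw [h.ratio_eq]
  exact div_pos (h.gw_ne _ (outerEnd_mem _) (by simp) (outerEnd_ne_zero _))
    (h.gw_ne _ (by simp) (by simp) (by norm_num))

lemma ratio_le_one (h : HasSummableDistortion F C lam) (a : ℕ → Bool) (n : ℕ) :
    ratio F a n ≤ 1 := by
  rw [h.ratio_eq]
  refine div_le_one_of_le₀ ?_ (abs_nonneg _)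
  rw [← h.len_Iw]
  exact h.abs_gw_sub_le _ (outerEnd_mem _) (by simp)

lemma abs_ratio_succ_sub_le (h : HasSummableDistortion F C lam) (a : ℕ → Bool) (n : ℕ) :
    |ratio F a (n + 1) - ratio F a n| ≤ C * lam ^ n := by
  refine (abs_sub_le_abs_log_sub (h.ratio_pos a _) (h.ratio_le_one a _) (h.ratio_pos a _)
    (h.ratio_le_one a _)).trans ?_
  rw [h.ratio_eq, h.ratio_eq]
  have := h.distortion (stem a n) (a (n + 1)) (outerEnd (a 0)) 0 (-1) 1 (outerEnd_mem _)
    (by simp) (by simp) (by simp) (outerEnd_ne_zero _) (by norm_num)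
  rwa [length_stem] at this

/-- The scaling function exists, with exponentially fast convergence. -/
lemma exists_scalingFun (h : HasSummableDistortion F C lam) : ∃ s : (ℕ → Bool) → ℝ,
    IsScalingFun F s ∧ ∀ a n, |ratio F a n - s a| ≤ C / (1 - lam) * lam ^ n := by
  have hstep : ∀ a n, dist (ratio F a n) (ratio F a (n + 1)) ≤ C * lam ^ n := fun a n => by
    rw [dist_comm]
    exact h.abs_ratio_succ_sub_le a n
  have hlim : ∀ a, ∃ L, Tendsto (ratio F a) atTop (𝓝 L) := fun a =>
    cauchySeq_tendsto_of_complete (cauchySeq_of_le_geometric lam C h.lam_mem.2 (hstep a))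
  choose s hs using hlim
  refine ⟨s, hs, fun a n => ?_⟩
  refine (dist_le_of_le_geometric_of_tendsto lam C h.lam_mem.2 (hstep a) (hs a) n).trans_eq ?_
  ring

lemma holderOnDual (h : HasSummableDistortion F C lam) {s : (ℕ → Bool) → ℝ}
    (hs : ∀ a n, |ratio F a n - s a| ≤ C / (1 - lam) * lam ^ n)
    (hlim : IsScalingFun F s) : HolderOnDual s := by
  have hl := h.lam_mem
  have hC := h.C_pos
  have h1 : 0 < 1 - lam := by linarith [hl.2]
  have hD : 0 < C / (1 - lam) := by positivity
  refine ⟨2 * (C / (1 - lam)) / lam + 1, by have := hl.1; positivity, lam, hl, ?_⟩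
  intro a b n hab
  rcases n with _ | n
  · have bound : ∀ a, 0 ≤ s a ∧ s a ≤ 1 := fun a =>
      ⟨ge_of_tendsto' (hlim a) fun n => (h.ratio_pos a n).le,
        le_of_tendsto' (hlim a) fun n => h.ratio_le_one a n⟩
    have h2 : 0 ≤ 2 * (C / (1 - lam)) / lam := by have := hl.1; positivity
    rw [pow_zero, mul_one, abs_le]
    constructor <;> linarith [(bound a).1, (bound a).2, (bound b).1, (bound b).2]
  · have e : ratio F a n = ratio F b n := by
      rw [h.ratio_eq, h.ratio_eq, hab 0 (by omega), stem_congr fun k hk => hab k (by omega)]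
    have h2 := hs a n
    have h3 := hs b n
    rw [e, abs_sub_comm] at h2
    have h4 := (abs_sub_le (s a) (ratio F b n) (s b)).trans (add_le_add h2 h3)
    have hl0 := hl.1
    have h5 : 2 * (C / (1 - lam)) / lam * lam ^ (n + 1) = 2 * (C / (1 - lam)) * lam ^ n := by
      rw [pow_succ]; field_simp
    have h6 : 0 < lam ^ (n + 1) := pow_pos hl0 _
    linarith

end HasSummableDistortion

end Distortion

section Conjugacy

variable {γ : ℝ} {f : ℝ → ℝ}

lemma hgam_mem (hγ : 1 < γ) {x : ℝ} (hx : x ∈ Icc (-1:ℝ) 1) : hgam γ x ∈ Icc (-1:ℝ) 1 := by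
  have m := (strictMonoOn_hgam hγ).monotoneOn
  have h1 := m (by simp) hx hx.1
  have h2 := m hx (by simp) hx.2
  rw [hgam_neg_one] at h1
  rw [hgam_one hγ] at h2
  exact ⟨h1, h2⟩

lemma hgam_mem_branchSet (hγ : 1 < γ) {b : Bool} {x : ℝ} (hx : x ∈ branchSet b) :
    hgam γ x ∈ branchSet b := by
  have m := (strictMonoOn_hgam hγ).monotoneOn
  have hx' := branchSet_subset b hx
  have h := hgam_mem hγ hx'
  cases b
  · have := m hx' (by simp) hx.2
    rw [hgam_zero hγ] at this
    exact ⟨h.1, this⟩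
  · have := m (by simp) hx' hx.1
    rw [hgam_zero hγ] at this
    exact ⟨this, h.2⟩

lemma exists_hgam_eq (hγ : 1 < γ) {b : Bool} {y : ℝ} (hy : y ∈ branchSet b) :
    ∃ x ∈ branchSet b, hgam γ x = y := by
  cases b
  · have := intermediate_value_Icc (by norm_num)
      ((continuousOn_hgam hγ).mono (branchSet_subset false))
    rw [hgam_neg_one, hgam_zero hγ] at this
    exact this hy
  · have := intermediate_value_Icc (by norm_num)
      ((continuousOn_hgam hγ).mono (branchSet_subset true))
    rw [hgam_zero hγ, hgam_one hγ] at this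
    exact this hy

lemma tildeF_hgam (hγ : 1 < γ) {x : ℝ} (hx : x ∈ Icc (-1:ℝ) 1) :
    tildeF γ f (hgam γ x) = hgam γ (f x) := by
  have : hgamInv γ (hgam γ x) = x := (strictMonoOn_hgam hγ).injOn.leftInvOn_invFunOn hx
  simp only [tildeF, Function.comp, this]

lemma IsFolding.tildeF (hγ : 1 < γ) (hf : IsFolding f)
    (hc : ∀ b, ContinuousOn (tildeF γ f) (branchSet b)) : IsFolding (tildeF γ f) where
  continuousOn := hc
  mono := by
    have m := strictMonoOn_hgam hγ
    intro x hx y hy hxy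
    obtain ⟨x', hx', rfl⟩ := exists_hgam_eq (b := false) hγ hx
    obtain ⟨y', hy', rfl⟩ := exists_hgam_eq (b := false) hγ hy
    rw [tildeF_hgam hγ (branchSet_subset _ hx'), tildeF_hgam hγ (branchSet_subset _ hy')]
    exact m (hf.maps_branchSet hx') (hf.maps_branchSet hy')
      (hf.mono hx' hy' ((m.lt_iff_lt (branchSet_subset _ hx') (branchSet_subset _ hy')).1 hxy))
  anti := by
    have m := strictMonoOn_hgam hγ
    intro x hx y hy hxy
    obtain ⟨x', hx', rfl⟩ := exists_hgam_eq (b := true) hγ hx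
    obtain ⟨y', hy', rfl⟩ := exists_hgam_eq (b := true) hγ hy
    rw [tildeF_hgam hγ (branchSet_subset _ hx'), tildeF_hgam hγ (branchSet_subset _ hy')]
    exact m (hf.maps_branchSet hy') (hf.maps_branchSet hx')
      (hf.anti hx' hy' ((m.lt_iff_lt (branchSet_subset _ hx') (branchSet_subset _ hy')).1 hxy))
  map_neg_one := by
    have := tildeF_hgam (f := f) hγ (x := -1) (by simp)
    rwa [hf.map_neg_one, hgam_neg_one] at this
  map_zero := by
    have := tildeF_hgam (f := f) hγ (x := 0) (by simp)
    rwa [hf.map_zero, hgam_one hγ, hgam_zero hγ] at this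
  map_one := by
    have := tildeF_hgam (f := f) hγ (x := 1) (by simp)
    rwa [hf.map_one, hgam_one hγ, hgam_neg_one] at this

lemma gw_tildeF (hγ : 1 < γ) (hf : IsFolding f) (hF : IsFolding (tildeF γ f)) (w : List Bool)
    {x : ℝ} (hx : x ∈ Icc (-1:ℝ) 1) :
    gw (tildeF γ f) w (hgam γ x) = hgam γ (gw f w x) := by
  induction w with
  | nil => rfl
  | cons b w ih =>
    have h1 := hf.gw_mem w hx
    have h2 := hf.branch_mem b h1
    simp only [gw, Function.comp, ih]
    rw [← hF.branch_map (hgam_mem_branchSet hγ h2), tildeF_hgam hγ (branchSet_subset b h2),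
      hf.map_branch b h1]

lemma len_Iw_tildeF_le (hγ : 1 < γ) (hf : IsFolding f) (hF : IsFolding (tildeF γ f)) {C lam : ℝ}
    (hC : 0 ≤ C) (hlam : 0 ≤ lam) (h : ∀ w : List Bool, len (Iw f w) ≤ C * lam ^ w.length)
    (w : List Bool) : len (Iw (tildeF γ f) w) ≤
      singNorm γ * (2 * γ) * C ^ γ⁻¹ * (lam ^ γ⁻¹) ^ w.length := by
  have h1 := gw_tildeF hγ hf hF w (x := -1) (by simp)
  have h2 := gw_tildeF hγ hf hF w (x := 1) (by simp)
  rw [hgam_neg_one] at h1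
  rw [hgam_one hγ] at h2
  have hn := singNorm_pos hγ
  rw [hF.len_Iw, h1, h2]
  refine (hgam_holder hγ (hf.gw_mem w (by simp)) (hf.gw_mem w (by simp))).trans ?_
  rw [mul_assoc _ (C ^ γ⁻¹)]
  refine mul_le_mul_of_nonneg_left ?_ (by positivity)
  have h3 := h w
  rw [hf.len_Iw] at h3
  refine (Real.rpow_le_rpow (abs_nonneg _) h3 (by positivity)).trans_eq ?_
  rw [Real.mul_rpow hC (pow_nonneg hlam _), ← Real.rpow_natCast,
    ← Real.rpow_mul hlam, mul_comm (w.length : ℝ), Real.rpow_mul hlam, Real.rpow_natCast]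

lemma abs_ratio_sub_ratio_le (hγ : 1 < γ) (hf : IsFolding f) {C lam : ℝ}
    (hF : HasSummableDistortion (tildeF γ f) C lam) {η : ℝ} (hη : 0 < η) :
    ∃ P : ℕ, ∀ (a : ℕ → Bool) (p n : ℕ), P ≤ p → a p = true → p < n →
      |ratio f a n - ratio (tildeF γ f) a n| ≤ η := by
  obtain ⟨ε, hε, H⟩ := ratio_comparison hγ hη
  obtain ⟨M, hM, hdist⟩ := hF.exists_div_le
  have hl := hF.lam_mem
  have hC := hF.C_pos
  obtain ⟨P, hP⟩ : ∃ P : ℕ, M * C * lam ^ P ≤ ε := by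
    obtain ⟨P, hP⟩ := exists_pow_lt_of_lt_one (div_pos hε (mul_pos hM hC)) hl.2
    refine ⟨P, ?_⟩
    rw [lt_div_iff₀ (mul_pos hM hC)] at hP
    linarith
  refine ⟨P + 1, fun a p n hp hap hpn => ?_⟩
  obtain ⟨n, rfl⟩ : ∃ k, n = k + 1 := ⟨n - 1, by omega⟩
  set q := Nat.findGreatest (fun k => a k = true) n with hq
  have hpq : p ≤ q := Nat.le_findGreatest (by omega) hap
  have haq : a q = true := Nat.findGreatest_spec (P := fun k => a k = true) (by omega) hap
  have hqn : q ≤ n := Nat.findGreatest_le n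
  have hzero : ∀ k, q < k → k ≤ q + (n - q) → a k = false := fun k h1 h2 => by
    simpa using Nat.findGreatest_is_greatest (P := fun k => a k = true) h1 (by omega)
  have hstem : stem a (n + 1) = (a (n + 1) :: List.replicate (n - q) false) ++ stem a q := by
    have := stem_add_of_zero (a := a) (n := q) (n - q) hzero
    rw [stem, List.cons_append, ← this]
    congr 2
    omega
  set u := a (n + 1) :: List.replicate (n - q) false with hu
  set F := tildeF γ f with hFdef
  have hm1 : (-1:ℝ) ∈ Icc (-1:ℝ) 1 := by simp
  have h01 : (1:ℝ) ∈ Icc (-1:ℝ) 1 := by simp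
  have hend : gw F u (-1) = branch F (a (n + 1)) (-1) := by
    simp only [hu, gw, Function.comp, hF.gw_replicate_neg_one]
  have hpos : ∀ x ∈ Icc (-1:ℝ) 1, 0 ≤ gw F (stem a q) x := by
    intro x hx
    obtain ⟨k, hk⟩ : ∃ k, q = k + 1 := ⟨q - 1, by omega⟩
    rw [hk] at haq ⊢
    rw [stem, haq]
    exact (hF.branch_mem true (hF.gw_mem _ hx)).1
  set X := gw F (stem a q) (-1) with hX
  set Y := gw F (stem a q) 1 with hY
  have hXm : X ∈ Icc (-1:ℝ) 1 := hF.gw_mem _ hm1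
  have hYm : Y ∈ Icc (-1:ℝ) 1 := hF.gw_mem _ h01
  have hXY : X ≠ Y := fun e => by
    have := hF.gw_injOn _ hm1 h01 e
    norm_num at this
  have hXYle : M * |X - Y| ≤ ε := by
    have h1 := hF.len_le (stem a q)
    rw [hF.len_Iw, length_stem] at h1
    calc M * |X - Y| ≤ M * (C * lam ^ P) := by
          refine mul_le_mul_of_nonneg_left (h1.trans ?_) hM.le
          exact mul_le_mul_of_nonneg_left
            (pow_le_pow_of_le_one hl.1.le hl.2.le (by omega)) hC.le
      _ ≤ ε := by rwa [← mul_assoc]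
  have small : ∀ Z ∈ Icc (-1:ℝ) 1, 0 ≤ Z →
      |gw F u X - gw F u Y| ≤ ε * |gw F u Z - branch F (a (n + 1)) (-1)| := by
    intro Z hZ hZ0
    have h1 := hdist u X Y Z (-1) hXm hYm hZ hm1 hXY (by linarith)
    rw [div_le_iff₀ (hF.gw_ne u hZ hm1 (by linarith)), hend] at h1
    refine h1.trans (mul_le_mul_of_nonneg_right ?_ (abs_nonneg _))
    refine le_trans ?_ hXYle
    refine mul_le_mul_of_nonneg_left (div_le_self (abs_nonneg _) ?_) hM.le
    rw [abs_of_nonneg (by linarith)]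
    linarith
  have sX := small X hXm (hpos _ hm1)
  have sY := small Y hYm (hpos _ h01)
  have conj : ∀ x ∈ Icc (-1:ℝ) 1,
      gw F (stem a (n + 1)) (hgam γ x) = hgam γ (gw f (stem a (n + 1)) x) := fun x hx =>
    gw_tildeF hγ hf hF.toIsFolding _ hx
  have c1 := conj (-1) hm1
  have c2 := conj 1 h01
  have c3 := conj 0 (by simp)
  have c4 := conj (outerEnd (a 0)) (outerEnd_mem _)
  rw [show hgam γ (outerEnd (a 0)) = outerEnd (a 0) by
    cases a 0
    · exact hgam_neg_one
    · exact hgam_one hγ] at c4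
  rw [hgam_neg_one] at c1
  rw [hgam_one hγ] at c2
  rw [hgam_zero hγ] at c3
  have hA : gw F (stem a (n + 1)) (-1) = gw F u X := by rw [hstem, IsFolding.gw_append]
  have hB : gw F (stem a (n + 1)) 1 = gw F u Y := by rw [hstem, IsFolding.gw_append]
  rw [hf.ratio_eq, hF.ratio_eq, c1, c2, c3, c4]
  refine H _ _ _ _ (hf.gw_mem_uIcc _ (outerEnd_mem _)) (hf.gw_mem_uIcc _ (by simp))
    (fun e => by have := hf.gw_injOn _ hm1 h01 e; norm_num at this) ?_
  rw [← c1, ← c2, hA, hB]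
  have m1 : gw f (stem a (n + 1)) (-1) ∈ branchSet (a (n + 1)) :=
    hf.branch_mem _ (hf.gw_mem _ hm1)
  have m2 : gw f (stem a (n + 1)) 1 ∈ branchSet (a (n + 1)) :=
    hf.branch_mem _ (hf.gw_mem _ h01)
  rcases hcase : a (n + 1) with _ | _
  · rw [hcase] at m1 m2 sX sY
    rw [hF.branch_false_neg_one, sub_neg_eq_add] at sX sY
    exact Or.inl ⟨m1, m2, sX, sY⟩
  · rw [hcase] at m1 m2 sX sY
    rw [hF.branch_true_neg_one] at sX sY
    exact Or.inr ⟨m1, m2, sX, sY⟩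

end Conjugacy

section FixedEnd

variable {γ : ℝ} {f : ℝ → ℝ}

lemma rpow_secant_lt (hγ : 1 < γ) {u v : ℝ} (hu : 0 ≤ u) (huv : u < v) (hv : v < 1) :
    (v ^ γ - u ^ γ) / (1 - u ^ γ) < (v - u) / (1 - u) := by
  have h := (strictConvexOn_rpow hγ).secant_strict_mono (a := u) (x := v) (y := 1) hu
    (hu.trans huv.le) (by simp) huv.ne' (by linarith) hv
  simp only [Real.one_rpow] at h
  have h1 : u ^ γ < 1 := Real.rpow_lt_one hu (huv.trans hv) (by linarith)
  rw [div_lt_div_iff₀ (by linarith) (by linarith)] at h ⊢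
  linarith

lemma tendsto_gw_replicate (hf : IsFolding f) {C lam : ℝ} (hlam : lam ∈ Ioo (0:ℝ) 1)
    (h : ∀ w : List Bool, len (Iw f w) ≤ C * lam ^ w.length) {x : ℝ} (hx : x ∈ Icc (-1:ℝ) 1) :
    Tendsto (fun m => gw f (List.replicate m false) x) atTop (𝓝 (-1)) := by
  rw [tendsto_iff_dist_tendsto_zero]
  have h0 : Tendsto (fun m : ℕ => C * lam ^ m) atTop (𝓝 0) := by
    simpa using (tendsto_pow_atTop_nhds_zero_of_lt_one hlam.1.le hlam.2).const_mul C
  refine squeeze_zero (fun _ => dist_nonneg) (fun m => ?_) h0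
  have h1 := hf.abs_gw_sub_le (List.replicate m false) hx (y := -1) (by simp)
  rw [hf.gw_replicate_neg_one] at h1
  have h2 := h (List.replicate m false)
  rw [List.length_replicate] at h2
  exact h1.trans h2

/-- Near the fixed endpoint `-1` the length ratios of `f` and of `f̃` along the inverse iterates
of the left branch have different limits. -/
lemma exists_tendsto_replicate (hγ : 1 < γ) (hf : IsFolding f) {C lam C' lam' : ℝ}
    (hF : HasSummableDistortion (tildeF γ f) C lam) (hlam' : lam' ∈ Ioo (0:ℝ) 1)
    (h : ∀ w : List Bool, len (Iw f w) ≤ C' * lam' ^ w.length)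
    {A B : ℕ → ℝ → ℝ} (hA : A = fun m => gw f (List.replicate m false))
    (hB : B = fun m => gw (tildeF γ f) (List.replicate m false))
    {X Y Z : ℝ} (hX : -1 ≤ X) (hXY : X < Y) (hYZ : Y < Z) (hZ : Z ≤ 1) :
    ∃ r t : ℝ, r < t ∧
      Tendsto (fun m => |A m X - A m Y| / |A m X - A m Z|) atTop (𝓝 r) ∧
      Tendsto (fun m => |A m Z - A m Y| / |A m Z - A m X|) atTop (𝓝 (1 - r)) ∧
      Tendsto (fun m => |B m (hgam γ X) - B m (hgam γ Y)| / |B m (hgam γ X) - B m (hgam γ Z)|)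
        atTop (𝓝 t) ∧
      Tendsto (fun m => |B m (hgam γ Z) - B m (hgam γ Y)| / |B m (hgam γ Z) - B m (hgam γ X)|)
        atTop (𝓝 (1 - t)) := by
  have mX : X ∈ Icc (-1:ℝ) 1 := ⟨hX, by linarith⟩
  have mY : Y ∈ Icc (-1:ℝ) 1 := ⟨by linarith, by linarith⟩
  have mZ : Z ∈ Icc (-1:ℝ) 1 := ⟨by linarith, hZ⟩
  have mono := strictMonoOn_hgam hγ
  have hBA : ∀ m, ∀ p ∈ Icc (-1:ℝ) 1, B m (hgam γ p) = hgam γ (A m p) := fun m p hp => by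
    rw [hA, hB]
    exact gw_tildeF hγ hf hF.toIsFolding _ hp
  have hAm : ∀ m, ∀ p ∈ Icc (-1:ℝ) 1, A m p ∈ Icc (-1:ℝ) 1 := fun m p hp => by
    rw [hA]
    exact hf.gw_mem _ hp
  have hA1 : ∀ m, A m (-1) = -1 := fun m => by
    rw [hA]
    exact hf.gw_replicate_neg_one m
  have hAmono : ∀ m, StrictMonoOn (A m) (Icc (-1) 1) := fun m => by
    rw [hA]
    exact hf.gw_replicate_strictMonoOn m
  set x : ℕ → ℝ := fun m => hgam γ (A m X) + 1 with hx
  set y : ℕ → ℝ := fun m => hgam γ (A m Y) + 1 with hy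
  set z : ℕ → ℝ := fun m => hgam γ (A m Z) + 1 with hz
  have hpt : ∀ m, ∀ p ∈ Icc (-1:ℝ) 1, 0 ≤ hgam γ (A m p) + 1 := fun m p hp => by
    have := (hgam_mem hγ (hAm m p hp)).1
    linarith
  have hlt : ∀ m, ∀ p ∈ Icc (-1:ℝ) 1, ∀ q ∈ Icc (-1:ℝ) 1, p < q →
      hgam γ (A m p) < hgam γ (A m q) := fun m p hp q hq hpq =>
    mono (hAm m p hp) (hAm m q hq) (hAmono m hp hq hpq)
  have hxy : ∀ m, x m < y m := fun m => by
    have := hlt m X mX Y mY hXY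
    simp only [hx, hy]
    linarith
  have hyz : ∀ m, y m < z m := fun m => by
    have := hlt m Y mY Z mZ hYZ
    simp only [hy, hz]
    linarith
  have hx0 : ∀ m, 0 ≤ x m := fun m => hpt m X mX
  have hz0 : ∀ m, 0 < z m := fun m => ((hx0 m).trans_lt (hxy m)).trans (hyz m)
  have lim : ∀ p ∈ Icc (-1:ℝ) 1, ∀ q ∈ Icc (-1:ℝ) 1, p < q → ∃ L > 0,
      Tendsto (fun m => ((hgam γ (A m q) + 1) - (hgam γ (A m p) + 1)) / z m) atTop (𝓝 L) := by
    intro p hp q hq hpq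
    obtain ⟨L, hL, ht⟩ := hF.exists_tendsto_div (fun m => List.replicate m false)
      (fun n => ⟨false, rfl⟩) (fun n => by simp) (hgam_mem hγ hq) (hgam_mem hγ hp)
      (hgam_mem hγ mZ) (v := -1) (by simp) (mono hp hq hpq).ne' (fun e => by
        have := mono (a := -1) (by simp) mZ (by linarith)
        rw [hgam_neg_one] at this
        linarith)
    refine ⟨L, hL, ht.congr fun m => ?_⟩
    have e1 := hBA m p hp
    have e2 := hBA m q hq
    have e3 := hBA m Z mZ
    rw [hB] at e1 e2 e3
    simp only at e1 e2 e3
    have h1 := hlt m p hp q hq hpq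
    have h2 := hz0 m
    simp only [hz] at h2 ⊢
    rw [e1, e2, e3, hF.gw_replicate_neg_one, abs_of_pos (by linarith), abs_of_pos (by linarith)]
    congr 1 <;> ring
  obtain ⟨L₁, hL₁, t₁⟩ := lim X mX Y mY hXY
  obtain ⟨L₂, hL₂, t₂⟩ := lim Y mY Z mZ hYZ
  change Tendsto (fun m => (y m - x m) / z m) _ _ at t₁
  change Tendsto (fun m => (z m - y m) / z m) _ _ at t₂
  set v := 1 - L₂ with hv
  set u := 1 - L₂ - L₁ with hu
  have tv : Tendsto (fun m => y m / z m) atTop (𝓝 v) := by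
    refine (t₂.const_sub 1).congr fun m => ?_
    have := (hz0 m).ne'
    field_simp
    ring
  have tu : Tendsto (fun m => x m / z m) atTop (𝓝 u) := by
    refine (tv.sub t₁).congr fun m => ?_
    have := (hz0 m).ne'
    field_simp
    ring
  have tz : Tendsto (fun m => z m / z m) atTop (𝓝 1) :=
    tendsto_const_nhds.congr fun m => (div_self (hz0 m).ne').symm
  have hu0 : 0 ≤ u := ge_of_tendsto' tu fun m => div_nonneg (hx0 m) (hz0 m).le
  have huv : u < v := by linarith
  have hv1 : v < 1 := by linarith
  have hu1 : u ^ γ < 1 := Real.rpow_lt_one hu0 (huv.trans hv1) (by linarith)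
  obtain ⟨c, hc, hθ⟩ := exists_tendsto_div_hgam_rpow hγ
  have power : ∀ p ∈ Icc (-1:ℝ) 1, ∀ s : ℝ,
      Tendsto (fun m => (hgam γ (A m p) + 1) / z m) atTop (𝓝 s) →
      Tendsto (fun m => (1 + A m p) / z m ^ γ) atTop (𝓝 (c * s ^ γ)) := by
    intro p hp s hs
    rcases hp.1.eq_or_lt with rfl | hp1
    · simp only [hA1, hgam_neg_one, neg_add_cancel, zero_div] at hs
      have : s = 0 := tendsto_nhds_unique hs tendsto_const_nhds
      rw [this, Real.zero_rpow (by linarith), mul_zero]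
      simp only [hA1, add_neg_cancel, zero_div]
      exact tendsto_const_nhds
    · have hgt : ∀ m, -1 < A m p := fun m => by
        have := hAmono m (a := -1) (by simp) hp hp1
        rwa [hA1] at this
      have hAlim : Tendsto (fun m => A m p) atTop (𝓝[>] (-1)) := by
        refine tendsto_nhdsWithin_iff.2 ⟨?_, Eventually.of_forall hgt⟩
        rw [hA]
        exact tendsto_gw_replicate hf hlam' h hp
      refine ((hθ.comp hAlim).mul (hs.rpow_const (p := γ) (Or.inr (by linarith)))).congr
        fun m => ?_
      have h1 : 0 < hgam γ (A m p) + 1 := by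
        have := mono (a := -1) (by simp) (hAm m p hp) (hgt m)
        rw [hgam_neg_one] at this
        linarith
      have h2 := (Real.rpow_pos_of_pos h1 γ).ne'
      have h3 := (Real.rpow_pos_of_pos (hz0 m) γ).ne'
      simp only [Function.comp]
      rw [Real.div_rpow h1.le (hz0 m).le]
      field_simp
  have pX := power X mX u tu
  have pY := power Y mY v tv
  have pZ := power Z mZ 1 tz
  rw [Real.one_rpow, mul_one] at pZ
  have hAXY : ∀ m, A m X < A m Y := fun m => hAmono m mX mY hXY
  have hAYZ : ∀ m, A m Y < A m Z := fun m => hAmono m mY mZ hYZ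
  have limA : Tendsto (fun m => |A m X - A m Y| / |A m X - A m Z|) atTop
      (𝓝 ((v ^ γ - u ^ γ) / (1 - u ^ γ))) := by
    have hne : c - c * u ^ γ ≠ 0 := by
      have : 0 < c * (1 - u ^ γ) := mul_pos hc (by linarith)
      linarith
    have e : (c * v ^ γ - c * u ^ γ) / (c - c * u ^ γ) = (v ^ γ - u ^ γ) / (1 - u ^ γ) := by
      rw [← mul_sub, show c - c * u ^ γ = c * (1 - u ^ γ) by ring,
        mul_div_mul_left _ _ hc.ne']
    rw [← e]
    refine ((pY.sub pX).div (pZ.sub pX) hne).congr fun m => ?_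
    have h3 := (Real.rpow_pos_of_pos (hz0 m) γ).ne'
    rw [abs_sub_comm, abs_sub_comm (A m X), abs_of_pos (by linarith [hAXY m]),
      abs_of_pos (by linarith [hAXY m, hAYZ m])]
    simp only [Pi.div_apply]
    rw [← sub_div, ← sub_div, div_div_div_cancel_right₀ h3]
    congr 1 <;> ring
  have limB : Tendsto
      (fun m => |B m (hgam γ X) - B m (hgam γ Y)| / |B m (hgam γ X) - B m (hgam γ Z)|)
      atTop (𝓝 ((v - u) / (1 - u))) := by
    refine ((tv.sub tu).div (tz.sub tu) (by linarith)).congr fun m => ?_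
    rw [hBA m X mX, hBA m Y mY, hBA m Z mZ]
    have h1 := hxy m
    have h2 := hyz m
    have h3 := (hz0 m).ne'
    simp only [hx, hy, hz] at h1 h2 h3 ⊢
    rw [abs_sub_comm, abs_sub_comm (hgam γ (A m X)), abs_of_pos (by linarith),
      abs_of_pos (by linarith)]
    simp only [Pi.div_apply]
    rw [← sub_div, ← sub_div, div_div_div_cancel_right₀ h3]
    congr 1 <;> ring
  refine ⟨_, _, rpow_secant_lt hγ hu0 huv hv1, limA, ?_, limB, ?_⟩
  · refine (limA.const_sub 1).congr fun m => ?_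
    have h1 := hAXY m
    have h2 := hAYZ m
    rw [abs_sub_comm (A m X) (A m Y), abs_sub_comm (A m X) (A m Z), abs_of_pos (by linarith),
      abs_of_pos (by linarith), abs_of_pos (by linarith), one_sub_div (by linarith)]
    congr 1
    ring
  · refine (limB.const_sub 1).congr fun m => ?_
    have h1 := hlt m X mX Y mY hXY
    have h2 := hlt m Y mY Z mZ hYZ
    rw [hBA m X mX, hBA m Y mY, hBA m Z mZ]
    rw [abs_sub_comm (hgam γ (A m X)) (hgam γ (A m Y)),
      abs_sub_comm (hgam γ (A m X)) (hgam γ (A m Z)), abs_of_pos (by linarith),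
      abs_of_pos (by linarith), abs_of_pos (by linarith), one_sub_div (by linarith)]
    congr 1
    ring

lemma exists_tendsto_ratio_of_evZero (hγ : 1 < γ) (hf : IsFolding f) {C lam C' lam' : ℝ}
    (hF : HasSummableDistortion (tildeF γ f) C lam) (hlam' : lam' ∈ Ioo (0:ℝ) 1)
    (h : ∀ w : List Bool, len (Iw f w) ≤ C' * lam' ^ w.length) {a : ℕ → Bool} (ha : EvZero a) :
    ∃ r t : ℝ, r ≠ t ∧ Tendsto (ratio f a) atTop (𝓝 r) ∧
      Tendsto (ratio (tildeF γ f) a) atTop (𝓝 t) := by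
  obtain ⟨N, hN⟩ := ha
  set e : ℝ := outerEnd (a 0) with he
  have hem : e ∈ Icc (-1:ℝ) 1 := outerEnd_mem _
  have hem' : -e ∈ Icc (-1:ℝ) 1 := ⟨by linarith [hem.2], by linarith [hem.1]⟩
  have hee : hgam γ e = e := by
    rw [he]
    cases a 0
    · exact hgam_neg_one
    · exact hgam_one hγ
  have hee' : hgam γ (-e) = -e := by rw [hgam_neg hγ hem, hee]
  have hstem : ∀ m, stem a (m + N) = List.replicate m false ++ stem a N := fun m => by
    rw [add_comm]
    exact stem_add_of_zero m fun k h1 _ => hN k h1.le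
  have ratio_eq' : ∀ {G : ℝ → ℝ}, IsFolding G → ∀ n,
      ratio G a n = |gw G (stem a n) e - gw G (stem a n) 0| /
        |gw G (stem a n) e - gw G (stem a n) (-e)| := by
    intro G hG n
    rw [hG.ratio_eq, he]
    cases a 0
    · simp [outerEnd]
    · simp only [outerEnd]
      rw [abs_sub_comm (gw G (stem a n) (-1))]
  set p := gw f (stem a N) e with hp
  set q := gw f (stem a N) (-e) with hq
  set o := gw f (stem a N) 0 with ho
  have mp : p ∈ Icc (-1:ℝ) 1 := hf.gw_mem _ hem
  have mq : q ∈ Icc (-1:ℝ) 1 := hf.gw_mem _ hem'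
  have hmem : o ∈ uIcc p q := by
    have h1 : gw f (stem a N) 0 ∈ uIcc (gw f (stem a N) (-1)) (gw f (stem a N) 1) :=
      hf.gw_mem_uIcc _ (by simp)
    rw [hp, hq, he]
    cases a 0
    · simpa [outerEnd] using h1
    · rw [uIcc_comm]
      simpa [outerEnd] using h1
  have hpo : p ≠ o := fun E => outerEnd_ne_zero _ (hf.gw_injOn _ hem (by simp) E)
  have hqo : q ≠ o := fun E => outerEnd_ne_zero (a 0)
    (neg_eq_zero.1 (hf.gw_injOn _ hem' (by simp) E))
  have ef : ∀ m, ratio f a (m + N) =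
      |gw f (List.replicate m false) p - gw f (List.replicate m false) o| /
        |gw f (List.replicate m false) p - gw f (List.replicate m false) q| := fun m => by
    rw [ratio_eq' hf, hstem, IsFolding.gw_append, IsFolding.gw_append, IsFolding.gw_append]
  have c1 := gw_tildeF hγ hf hF.toIsFolding (stem a N) hem
  have c2 := gw_tildeF hγ hf hF.toIsFolding (stem a N) hem'
  have c3 := gw_tildeF hγ hf hF.toIsFolding (stem a N) (x := 0) (by simp)
  rw [hee] at c1
  rw [hee'] at c2
  rw [hgam_zero hγ] at c3
  have eF : ∀ m, ratio (tildeF γ f) a (m + N) =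
      |gw (tildeF γ f) (List.replicate m false) (hgam γ p) -
        gw (tildeF γ f) (List.replicate m false) (hgam γ o)| /
        |gw (tildeF γ f) (List.replicate m false) (hgam γ p) -
          gw (tildeF γ f) (List.replicate m false) (hgam γ q)| := fun m => by
    rw [ratio_eq' hF.toIsFolding, hstem, IsFolding.gw_append, IsFolding.gw_append,
      IsFolding.gw_append, c1, c2, c3]
  rcases mem_uIcc.1 hmem with ⟨h1, h2⟩ | ⟨h1, h2⟩
  · obtain ⟨r, t, hrt, l1, -, l2, -⟩ := exists_tendsto_replicate hγ hf hF hlam' h rfl rfl mp.1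
      (lt_of_le_of_ne h1 hpo) (lt_of_le_of_ne h2 hqo.symm) mq.2
    exact ⟨r, t, hrt.ne, (tendsto_add_atTop_iff_nat N).1 (l1.congr fun m => (ef m).symm),
      (tendsto_add_atTop_iff_nat N).1 (l2.congr fun m => (eF m).symm)⟩
  · obtain ⟨r, t, hrt, -, l1, -, l2⟩ := exists_tendsto_replicate hγ hf hF hlam' h rfl rfl mq.1
      (lt_of_le_of_ne h1 hqo) (lt_of_le_of_ne h2 hpo.symm) mp.2
    exact ⟨1 - r, 1 - t, by intro E; linarith,
      (tendsto_add_atTop_iff_nat N).1 (l1.congr fun m => (ef m).symm),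
      (tendsto_add_atTop_iff_nat N).1 (l2.congr fun m => (eF m).symm)⟩

end FixedEnd

section DualCantorSet

lemma eventually_agree (a : ℕ → Bool) (M : ℕ) : ∀ᶠ b in 𝓝 a, ∀ k < M, b k = a k := by
  have h : ∀ k ∈ Finset.range M, ∀ᶠ b in 𝓝 a, b k = a k := fun k _ =>
    (continuous_apply k).continuousAt.preimage_mem_nhds ((isOpen_discrete {a k}).mem_nhds rfl)
  filter_upwards [(Filter.eventually_all_finset _).2 h] with b hb k hk
  exact hb k (Finset.mem_range.2 hk)

/-- Punctured neighbourhoods in the dual Cantor set consist of strings with a late digit `1`. -/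
lemma eventually_exists_true (a : ℕ → Bool) (P : ℕ) : ∀ᶠ b in 𝓝[≠] a, ∃ p ≥ P, b p = true := by
  by_cases ha : EvZero a
  · obtain ⟨N, hN⟩ := ha
    filter_upwards [nhdsWithin_le_nhds (eventually_agree a (max P N)), self_mem_nhdsWithin]
      with b hb hba
    obtain ⟨k, hk⟩ := Function.ne_iff.1 hba
    have hk' : max P N ≤ k := not_lt.1 fun h => hk (hb k h)
    rw [hN k ((le_max_right _ _).trans hk')] at hk
    exact ⟨k, (le_max_left _ _).trans hk', by simpa using hk⟩
  · simp only [EvZero, not_exists, not_forall] at ha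
    obtain ⟨p, hp, hap⟩ := ha P
    filter_upwards [nhdsWithin_le_nhds (eventually_agree a (p + 1))] with b hb
    exact ⟨p, hp, by simpa [hb p (Nat.lt_succ_self p)] using hap⟩

lemma HolderOnDual.continuous {s : (ℕ → Bool) → ℝ} (hs : HolderOnDual s) : Continuous s := by
  obtain ⟨C, hC, lam, hlam, H⟩ := hs
  refine continuous_iff_continuousAt.2 fun a => Metric.tendsto_nhds.2 fun ε hε => ?_
  obtain ⟨M, hM⟩ := exists_pow_lt_of_lt_one (div_pos hε hC) hlam.2
  rw [lt_div_iff₀ hC] at hM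
  filter_upwards [eventually_agree a M] with b hb
  rw [Real.dist_eq]
  exact (H b a M hb).trans_lt (by linarith)

lemma tendsto_punctured_of_close {s t : (ℕ → Bool) → ℝ} (ht : Continuous t)
    (h : ∀ η > (0:ℝ), ∃ P : ℕ, ∀ (a : ℕ → Bool) (p : ℕ), P ≤ p → a p = true → |s a - t a| ≤ η)
    (a : ℕ → Bool) : Tendsto s (𝓝[≠] a) (𝓝 (t a)) := by
  have hd : Tendsto (fun b => s b - t b) (𝓝[≠] a) (𝓝 0) := by
    refine Metric.tendsto_nhds.2 fun ε hε => ?_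
    obtain ⟨P, hP⟩ := h (ε / 2) (half_pos hε)
    filter_upwards [eventually_exists_true a P] with b ⟨p, hp, hbp⟩
    rw [Real.dist_eq, sub_zero]
    exact (hP b p hp hbp).trans_lt (half_lt_self hε)
  simpa using hd.add (ht.continuousAt.mono_left nhdsWithin_le_nhds)

end DualCantorSet

/-- Theorem C: if `f` is on the boundary of hyperbolicity and `f̃` is `f`
viewed in the singular metric associated to `f`, then the scaling functions `s_f` and
`s_{f̃}` both exist; `s_{f̃}` is Hölder continuous on the dual Cantor set; `s_f` has jump
discontinuities at all points of `𝒜` and is continuous at all points of `ℬ`; and `s_f`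
agrees with `s_{f̃}` on `ℬ`. -/
theorem scaling_function_boundary_of_hyperbolicity (γ : ℝ) (hγ : 1 < γ) (f fd : ℝ → ℝ)
    (hmaps : MapsTo f (Icc (-1) 1) (Icc (-1) 1))
    (hderiv : ∀ x ∈ Icc (-1:ℝ) 1, HasDerivWithinAt f (fd x) (Icc (-1) 1) x)
    (hfd_cont : ContinuousOn fd (Icc (-1) 1))
    (hmono : StrictMonoOn f (Icc (-1) 0)) (hanti : StrictAntiOn f (Icc 0 1))
    (hf0 : f 0 = 1) (hfm1 : f (-1) = -1) (hf1 : f 1 = -1)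
    (hpow_left : ∃ A : ℝ, A ≠ 0 ∧
      Tendsto (fun x => fd x / |x| ^ (γ - 1)) (nhdsWithin 0 (Iio 0)) (nhds A))
    (hpow_right : ∃ B : ℝ, B ≠ 0 ∧
      Tendsto (fun x => fd x / |x| ^ (γ - 1)) (nhdsWithin 0 (Ioi 0)) (nhds B))
    (hBH : ∃ α ∈ Ioc (0:ℝ) 1, ∃ K > (0:ℝ), ∃ d0 d1 : ℝ → ℝ,
      (∀ x ∈ Icc (-1:ℝ) 0, HasDerivWithinAt (tildeF γ f) (d0 x) (Icc (-1) 0) x) ∧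
      (∀ x ∈ Icc (-1:ℝ) 0, d0 x ≠ 0) ∧
      (∀ x ∈ Icc (-1:ℝ) 0, ∀ y ∈ Icc (-1:ℝ) 0, |d0 x - d0 y| ≤ K * |x - y| ^ α) ∧
      (∀ x ∈ Icc (0:ℝ) 1, HasDerivWithinAt (tildeF γ f) (d1 x) (Icc 0 1) x) ∧
      (∀ x ∈ Icc (0:ℝ) 1, d1 x ≠ 0) ∧
      (∀ x ∈ Icc (0:ℝ) 1, ∀ y ∈ Icc (0:ℝ) 1, |d1 x - d1 y| ≤ K * |x - y| ^ α))
    (hdecay : ∃ C > (0:ℝ), ∃ lam ∈ Ioo (0:ℝ) 1, ∀ n : ℕ, ∀ w : List Bool,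
      w.length = n + 1 → len (Iw f w) ≤ C * lam ^ n) :
    ∃ sf st : (ℕ → Bool) → ℝ,
      IsScalingFun f sf ∧ IsScalingFun (tildeF γ f) st ∧
      HolderOnDual st ∧
      (∀ a : ℕ → Bool, EvZero a →
        ∃ L : ℝ, Tendsto sf (nhdsWithin a {a}ᶜ) (nhds L) ∧ L ≠ sf a) ∧
      (∀ a : ℕ → Bool, ¬ EvZero a → ContinuousAt sf a) ∧
      (∀ a : ℕ → Bool, ¬ EvZero a → sf a = st a) := by
  have hf : IsFolding f :=
    ⟨fun b => ContinuousOn.mono (fun x hx => (hderiv x hx).continuousWithinAt)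
      (branchSet_subset b), hmono, hanti, hfm1, hf0, hf1⟩
  obtain ⟨C, hC, lam, hlam, hdec⟩ := hdecay
  have hC' : 0 < C / lam + 2 := by have := div_pos hC hlam.1; linarith
  have hlen : ∀ w : List Bool, len (Iw f w) ≤ (C / lam + 2) * lam ^ w.length := by
    intro w
    cases w with
    | nil =>
      have := div_pos hC hlam.1
      rw [hf.len_Iw]
      norm_num [gw]
      linarith
    | cons b w =>
      have h1 := hdec w.length (b :: w) rfl
      have h2 : 0 < lam ^ (w.length + 1) := pow_pos hlam.1 _
      have h3 : C * lam ^ w.length = C / lam * lam ^ (w.length + 1) := by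
        have := hlam.1.ne'
        rw [pow_succ]
        field_simp
      rw [List.length_cons, add_mul, ← h3]
      linarith
  obtain ⟨α, hα, K, hK, d0, d1, hd0, hn0, hH0, hd1, hn1, hH1⟩ := hBH
  have hFold : IsFolding (tildeF γ f) := hf.tildeF hγ fun b => by
    cases b
    · exact fun x hx => (hd0 x hx).continuousWithinAt
    · exact fun x hx => (hd1 x hx).continuousWithinAt
  have hγ0 : 0 < γ⁻¹ := inv_pos.2 (by linarith)
  have hsing := singNorm_pos hγ
  obtain ⟨C', lam', hF⟩ := hFold.exists_hasSummableDistortion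
    (d := fun b => bif b then d1 else d0) hα hK
    (Bool.forall_bool.2 ⟨hd0, hd1⟩) (Bool.forall_bool.2 ⟨hn0, hn1⟩)
    (Bool.forall_bool.2 ⟨hH0, hH1⟩)
    (C := singNorm γ * (2 * γ) * (C / lam + 2) ^ γ⁻¹) (by positivity)
    ⟨Real.rpow_pos_of_pos hlam.1 _, Real.rpow_lt_one hlam.1.le hlam.2 hγ0⟩
    (len_Iw_tildeF_le hγ hf hFold hC'.le hlam.1.le hlen)
  obtain ⟨st, hst, hbound⟩ := hF.exists_scalingFun
  have hHolder : HolderOnDual st := hF.holderOnDual hbound hst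
  have hex : ∀ a, ∃ s, Tendsto (ratio f a) atTop (𝓝 s) ∧
      (EvZero a → st a ≠ s) ∧ (¬ EvZero a → s = st a) := by
    intro a
    by_cases ha : EvZero a
    · obtain ⟨r, t, hrt, hr, ht⟩ := exists_tendsto_ratio_of_evZero hγ hf hF hlam hlen ha
      refine ⟨r, hr, fun _ => ?_, fun h => absurd ha h⟩
      rw [tendsto_nhds_unique (hst a) ht]
      exact hrt.symm
    · refine ⟨st a, ?_, fun h => absurd h ha, fun _ => rfl⟩
      have hd : Tendsto (fun n => ratio f a n - ratio (tildeF γ f) a n) atTop (𝓝 0) := by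
        refine Metric.tendsto_nhds.2 fun ε hε => ?_
        obtain ⟨P, hP⟩ := abs_ratio_sub_ratio_le hγ hf hF (half_pos hε)
        simp only [EvZero, not_exists, not_forall] at ha
        obtain ⟨p, hp, hap⟩ := ha P
        filter_upwards [eventually_gt_atTop p] with n hn
        rw [Real.dist_eq, sub_zero]
        exact (hP a p n hp (by simpa using hap) hn).trans_lt (half_lt_self hε)
      simpa using hd.add (hst a)
  choose sf hsf hne heq using hex
  have hclose : ∀ η > (0:ℝ), ∃ P : ℕ, ∀ (a : ℕ → Bool) (p : ℕ), P ≤ p → a p = true →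
      |sf a - st a| ≤ η := by
    intro η hη
    obtain ⟨P, hP⟩ := abs_ratio_sub_ratio_le hγ hf hF hη
    refine ⟨P, fun a p hp hap => le_of_tendsto ((hsf a).sub (hst a)).abs ?_⟩
    filter_upwards [eventually_gt_atTop p] with n hn using hP a p n hp hap hn
  have hlim := tendsto_punctured_of_close hHolder.continuous hclose
  refine ⟨sf, st, hsf, hst, hHolder, fun a ha => ⟨st a, hlim a, hne a ha⟩, fun a ha => ?_, heq⟩
  refine continuousAt_iff_punctured_nhds.2 ?_
  rw [heq a ha]
  exact hlim a
end

section
/- Assume that (a) {F_ε}_{0≤ε≤ε₀} is a family of C³ embeddings of [-1,0] into the real line with nonpositive Schwarzian derivative, (b) each F_ε fixes −1 and maps 0 to 1+ε, (c) F_ε'(−1) > 1/γ for a fixed γ > 1, and (d) (x,ε) ↦ F_ε(x) is C² jointly in both variables. Set f_ε(x) = F_ε(−|x|^γ) on [-1,1]. Then {f_ε}_{0≤ε≤ε₀} is a good family; in particular there are constants C₀ > 0 and 0 < λ < 1 such that λ_{n,ε} ≤ C₀λⁿ for all n ≥ 1 and all 0 ≤ ε ≤ ε₀. -/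
open Set MeasureTheory Filter Topology

lemma inv_sqrt_tangent_le {D D' D'' : ℝ → ℝ} {a b u s : ℝ}
    (hpos : ∀ x ∈ Ioo a b, 0 < D x)
    (h1 : ∀ x ∈ Ioo a b, HasDerivAt D (D' x) x)
    (h2 : ∀ x ∈ Ioo a b, HasDerivAt D' (D'' x) x)
    (hS : ∀ x ∈ Ioo a b, D'' x / D x - 3 / 2 * (D' x / D x) ^ 2 ≤ 0)
    (hu : u ∈ Ioo a b) (hs : s ∈ Ioo a b) :
    (√(D u))⁻¹ + -(D' u) / (2 * D u * √(D u)) * (s - u) ≤ (√(D s))⁻¹ := by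
  have hφ : ∀ x ∈ Ioo a b,
      HasDerivAt (fun y => (√(D y))⁻¹) (-(D' x) / (2 * D x * √(D x))) x := by
    intro x hx
    have hp := hpos x hx
    have hsq := Real.sqrt_pos.2 hp
    have hsq2 := Real.sq_sqrt hp.le
    refine (((h1 x hx).sqrt hp.ne').inv hsq.ne').congr_deriv ?_
    rw [hsq2]
    field_simp
  have hφ' : ∀ x ∈ Ioo a b, HasDerivAt (fun y => -(D' y) / (2 * D y * √(D y)))
      (-(1 / 2) * (√(D x))⁻¹ * (D'' x / D x - 3 / 2 * (D' x / D x) ^ 2)) x := by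
    intro x hx
    have hp := hpos x hx
    have hsq := Real.sqrt_pos.2 hp
    have hsq2 := Real.sq_sqrt hp.le
    have hden : 2 * D x * √(D x) ≠ 0 := by positivity
    refine (((h2 x hx).neg).fun_div (((h1 x hx).const_mul 2).mul ((h1 x hx).sqrt hp.ne'))
      hden).congr_deriv ?_
    simp only [Pi.mul_apply, Pi.neg_apply]
    generalize √(D x) = r at *
    rw [← hsq2]
    field_simp
    ring
  have hconv : ConvexOn ℝ (Ioo a b) (fun y => (√(D y))⁻¹) := by
    refine convexOn_of_hasDerivWithinAt2_nonneg (convex_Ioo a b)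
      (fun x hx => (hφ x hx).continuousAt.continuousWithinAt)
      (f' := fun y => -(D' y) / (2 * D y * √(D y)))
      (f'' := fun x => -(1 / 2) * (√(D x))⁻¹ * (D'' x / D x - 3 / 2 * (D' x / D x) ^ 2)) ?_ ?_ ?_
    · intro x hx
      rw [interior_Ioo] at hx ⊢
      exact (hφ x hx).hasDerivWithinAt
    · intro x hx
      rw [interior_Ioo] at hx ⊢
      exact (hφ' x hx).hasDerivWithinAt
    · intro x hx
      rw [interior_Ioo] at hx
      have h := hS x hx
      have : 0 ≤ (√(D x))⁻¹ := by positivity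
      nlinarith
  rcases lt_trichotomy u s with h | h | h
  · have := hconv.le_slope_of_hasDerivAt hu hs h (hφ u hu)
    rw [slope_def_field, le_div_iff₀ (by linarith)] at this
    linarith
  · subst h; simp
  · have := hconv.slope_le_of_hasDerivAt hs hu h (hφ u hu)
    rw [slope_def_field, div_le_iff₀ (by linarith)] at this
    linarith

lemma sub_le_of_inv_sqrt_deriv_ge {F D : ℝ → ℝ} {c d u p m : ℝ} (hcd : c ≤ d) (hp : 0 < p)
    (hF : ContinuousOn F (Icc c d)) (hD : ∀ x ∈ Ioo c d, HasDerivAt F (D x) x)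
    (hpos : ∀ x ∈ Ioo c d, 0 < D x)
    (hL : ∀ x ∈ Icc c d, 0 < p + m * (x - u))
    (hle : ∀ x ∈ Ioo c d, p + m * (x - u) ≤ (√(D x))⁻¹) :
    F d - F c ≤ (d - u) / (p * (p + m * (d - u))) - (c - u) / (p * (p + m * (c - u))) := by
  have hmono : MonotoneOn (fun x => (x - u) / (p * (p + m * (x - u))) - F x) (Icc c d) := by
    refine monotoneOn_of_hasDerivWithinAt_nonneg (convex_Icc c d)
      (f' := fun x => ((p + m * (x - u)) ^ 2)⁻¹ - D x) ?_ ?_ ?_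
    · refine ContinuousOn.sub (ContinuousOn.div (by fun_prop) (by fun_prop) ?_) hF
      intro x hx
      exact (mul_pos hp (hL x hx)).ne'
    · intro x hx
      rw [interior_Icc] at hx ⊢
      have hLx := hL x (Ioo_subset_Icc_self hx)
      have h1 : HasDerivAt (fun x => x - u) 1 x := (hasDerivAt_id x).sub_const u
      have h2 : HasDerivAt (fun x => p * (p + m * (x - u))) (p * (m * 1)) x :=
        ((h1.const_mul m).const_add p).const_mul p
      refine HasDerivAt.hasDerivWithinAt ((h1.fun_div h2 (mul_pos hp hLx).ne').sub
        (hD x hx) |>.congr_deriv ?_)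
      congr 1
      field_simp
      ring
    · intro x hx
      rw [interior_Icc] at hx
      have hLx := hL x (Ioo_subset_Icc_self hx)
      have hDx := hpos x hx
      have := hle x hx
      rw [sub_nonneg, le_inv_comm₀ hDx (by positivity)]
      calc (p + m * (x - u)) ^ 2 ≤ ((√(D x))⁻¹) ^ 2 := by gcongr
        _ = (D x)⁻¹ := by rw [inv_pow, Real.sq_sqrt hDx.le]
  have := hmono (left_mem_Icc.2 hcd) (right_mem_Icc.2 hcd) hcd
  simp only at this
  linarith

/-- Maps with nonpositive Schwarzian derivative expand the cross-ratio metric of an interval. -/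
lemma mul_sub_mul_sub_le_of_schwarzian_nonpos {F D D' D'' : ℝ → ℝ} {a b u : ℝ}
    (hF : ContinuousOn F (Icc a b)) (h0 : ∀ x ∈ Ioo a b, HasDerivAt F (D x) x)
    (hpos : ∀ x ∈ Ioo a b, 0 < D x)
    (h1 : ∀ x ∈ Ioo a b, HasDerivAt D (D' x) x)
    (h2 : ∀ x ∈ Ioo a b, HasDerivAt D' (D'' x) x)
    (hS : ∀ x ∈ Ioo a b, D'' x / D x - 3 / 2 * (D' x / D x) ^ 2 ≤ 0)
    (hmono : MonotoneOn F (Icc a b)) (hu : u ∈ Ioo a b) :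
    (F u - F a) * (F b - F u) * (b - a) ≤ (F b - F a) * D u * (u - a) * (b - u) := by
  have ht : ∀ s ∈ Ioo a b, _ := fun s hs => inv_sqrt_tangent_le hpos h1 h2 hS hu hs
  set p := (√(D u))⁻¹ with hp_def
  set m := -(D' u) / (2 * D u * √(D u))
  have hDu := hpos u hu
  have hp : 0 < p := inv_pos.2 (Real.sqrt_pos.2 hDu)
  have hpD : p ^ 2 * D u = 1 := by
    rw [hp_def, inv_pow, Real.sq_sqrt hDu.le, inv_mul_cancel₀ hDu.ne']
  have hab : a ≤ b := (hu.1.trans hu.2).le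
  have hA : 0 ≤ F u - F a :=
    sub_nonneg.2 (hmono (left_mem_Icc.2 hab) (Ioo_subset_Icc_self hu) hu.1.le)
  have hB : 0 ≤ F b - F u :=
    sub_nonneg.2 (hmono (Ioo_subset_Icc_self hu) (right_mem_Icc.2 hab) hu.2.le)
  have hua := sub_pos.2 hu.1
  have hbu := sub_pos.2 hu.2
  have hright : (F b - F u) * (p * (p + m * (b - u))) ≤ b - u := by
    rcases le_or_gt (p + m * (b - u)) 0 with hneg | hL
    · have : (F b - F u) * (p * (p + m * (b - u))) ≤ 0 :=
        mul_nonpos_of_nonneg_of_nonpos hB (mul_nonpos_of_nonneg_of_nonpos hp.le hneg)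
      linarith
    · have key := sub_le_of_inv_sqrt_deriv_ge (F := F) (D := D) (u := u) (m := m) hu.2.le hp
        (hF.mono (Icc_subset_Icc_left hu.1.le))
        (fun x hx => h0 x ⟨hu.1.trans hx.1, hx.2⟩) (fun x hx => hpos x ⟨hu.1.trans hx.1, hx.2⟩)
        (fun x hx => by
          rcases le_or_gt 0 m with hm | hm
          · nlinarith [mul_nonneg hm (sub_nonneg.2 hx.1)]
          · nlinarith [hx.2])
        (fun x hx => ht x ⟨hu.1.trans hx.1, hx.2⟩)
      simp only [sub_self, zero_div, sub_zero] at key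
      rwa [le_div_iff₀ (mul_pos hp hL)] at key
  have hleft : (F u - F a) * (p * (p + m * (a - u))) ≤ u - a := by
    rcases le_or_gt (p + m * (a - u)) 0 with hneg | hL
    · have : (F u - F a) * (p * (p + m * (a - u))) ≤ 0 :=
        mul_nonpos_of_nonneg_of_nonpos hA (mul_nonpos_of_nonneg_of_nonpos hp.le hneg)
      linarith
    · have key := sub_le_of_inv_sqrt_deriv_ge (F := F) (D := D) (u := u) (m := m) hu.1.le hp
        (hF.mono (Icc_subset_Icc_right hu.2.le))
        (fun x hx => h0 x ⟨hx.1, hx.2.trans hu.2⟩) (fun x hx => hpos x ⟨hx.1, hx.2.trans hu.2⟩)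
        (fun x hx => by
          rcases le_or_gt m 0 with hm | hm
          · nlinarith [mul_nonneg_of_nonpos_of_nonpos hm (sub_nonpos.2 hx.2)]
          · nlinarith [hx.1])
        (fun x hx => ht x ⟨hx.1, hx.2.trans hu.2⟩)
      simp only [sub_self, zero_div, zero_sub, ← neg_div, neg_sub] at key
      rwa [le_div_iff₀ (mul_pos hp hL)] at key
  have e1 := mul_le_mul_of_nonneg_left hleft (mul_nonneg hB hbu.le)
  have e2 := mul_le_mul_of_nonneg_left hright (mul_nonneg hA hua.le)
  have e3 : (F u - F a) * (F b - F u) * (b - a) * p ^ 2 ≤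
      (F b - F a) * (u - a) * (b - u) := by linear_combination e1 + e2
  have e4 := mul_le_mul_of_nonneg_right e3 hDu.le
  linear_combination e4 - (F u - F a) * (F b - F u) * (b - a) * hpD

lemma intervalIntegrable_one_sub_sq_rpow {r : ℝ} (hr : -1 < r) :
    IntervalIntegrable (fun u : ℝ => (1 - u ^ 2) ^ r) volume (-1) 1 := by
  have h1 : IntervalIntegrable (fun u : ℝ => (1 - u) ^ r) volume 0 1 := by
    simpa using ((intervalIntegral.intervalIntegrable_rpow' hr
      (a := 0) (b := 1)).comp_sub_left (c := 1)).symm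
  have h2 : IntervalIntegrable (fun u : ℝ => (1 - u ^ 2) ^ r) volume 0 1 := by
    have h3 : ContinuousOn (fun u : ℝ => (1 + u) ^ r) (uIcc 0 1) := by
      rw [uIcc_of_le zero_le_one]
      refine ContinuousOn.rpow_const (by fun_prop) fun x hx => Or.inl ?_
      linarith [hx.1]
    refine (h1.mul_continuousOn h3).congr fun u hu => ?_
    rw [uIoc_of_le zero_le_one] at hu
    rw [← Real.mul_rpow (by linarith [hu.2]) (by linarith [hu.1])]
    ring_nf
  have h4 : IntervalIntegrable (fun u : ℝ => (1 - u ^ 2) ^ r) volume (-1) 0 := by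
    have := (IntervalIntegrable.iff_comp_neg (by simp) |>.1 h2).symm
    simpa using this
  exact h4.trans h2

/-- The primitive of the weight `(1 - u ^ 2) ^ r`. -/
noncomputable def weightPrimitive (r x : ℝ) : ℝ := ∫ u in (0:ℝ)..x, (1 - u ^ 2) ^ r

lemma weightPrimitive_neg (r x : ℝ) : weightPrimitive r (-x) = -weightPrimitive r x := by
  unfold weightPrimitive
  have := intervalIntegral.integral_comp_neg (a := 0) (b := x) (fun u : ℝ => (1 - u ^ 2) ^ r)
  simp only [neg_sq, neg_zero] at this
  rw [this, intervalIntegral.integral_symm]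

lemma continuousOn_weightPrimitive {r : ℝ} (hr : -1 < r) :
    ContinuousOn (weightPrimitive r) (Icc (-1) 1) := by
  have h := intervalIntegral.continuousOn_primitive_interval' (a := 0)
    (intervalIntegrable_one_sub_sq_rpow hr) (by rw [uIcc_of_le (by norm_num)]; norm_num)
  rwa [uIcc_of_le (by norm_num)] at h

lemma hasDerivAt_weightPrimitive {r : ℝ} (hr : -1 < r) {x : ℝ} (hx : x ∈ Ioo (-1:ℝ) 1) :
    HasDerivAt (weightPrimitive r) ((1 - x ^ 2) ^ r) x := by
  have hpos : ∀ y ∈ Ioo (-1:ℝ) 1, 1 - y ^ 2 ≠ 0 := fun y hy => by nlinarith [hy.1, hy.2]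
  have hc : ContinuousOn (fun u : ℝ => (1 - u ^ 2) ^ r) (Ioo (-1) 1) :=
    ContinuousOn.rpow_const (by fun_prop) fun y hy => Or.inl (hpos y hy)
  refine intervalIntegral.integral_hasDerivAt_right
    ((intervalIntegrable_one_sub_sq_rpow hr).mono_set ?_)
    (hc.stronglyMeasurableAtFilter isOpen_Ioo x hx) (hc.continuousAt (isOpen_Ioo.mem_nhds hx))
  rw [uIcc_of_le (show (-1:ℝ) ≤ 1 by norm_num)]
  exact uIcc_subset_Icc (by norm_num) (Ioo_subset_Icc_self hx)

lemma sub_le_weightPrimitive_sub {r : ℝ} (hr : -1 < r) (hr0 : r ≤ 0) {x y : ℝ}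
    (hx : x ∈ Icc (-1:ℝ) 1) (hy : y ∈ Icc (-1:ℝ) 1) (hxy : x ≤ y) :
    y - x ≤ weightPrimitive r y - weightPrimitive r x := by
  have hmono : MonotoneOn (fun x => weightPrimitive r x - x) (Icc (-1) 1) := by
    refine monotoneOn_of_hasDerivWithinAt_nonneg (convex_Icc _ _)
      (f' := fun x => (1 - x ^ 2) ^ r - 1)
      ((continuousOn_weightPrimitive hr).sub continuousOn_id) ?_ ?_
    · intro x hx
      rw [interior_Icc] at hx ⊢
      exact ((hasDerivAt_weightPrimitive hr hx).sub (hasDerivAt_id x)).hasDerivWithinAt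
    · intro x hx
      rw [interior_Icc] at hx
      have := Real.one_le_rpow_of_pos_of_le_one_of_nonpos
        (show 0 < 1 - x ^ 2 by nlinarith [hx.1, hx.2]) (by nlinarith [sq_nonneg x]) hr0
      linarith
  have := hmono hx hy hxy
  simp only at this
  linarith

lemma abs_sub_le_abs_weightPrimitive_sub {r : ℝ} (hr : -1 < r) (hr0 : r ≤ 0) {x y : ℝ}
    (hx : x ∈ Icc (-1:ℝ) 1) (hy : y ∈ Icc (-1:ℝ) 1) :
    |x - y| ≤ |weightPrimitive r x - weightPrimitive r y| := by
  wlog hxy : x ≤ y generalizing x y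
  · rw [abs_sub_comm x, abs_sub_comm (weightPrimitive r x)]
    exact this hy hx (le_of_not_ge hxy)
  have := sub_le_weightPrimitive_sub hr hr0 hx hy hxy
  rw [abs_sub_comm x, abs_sub_comm (weightPrimitive r x), abs_of_nonneg (by linarith)]
  exact this.trans (le_abs_self _)

lemma len_Iw_le_of_contraction {f h : ℝ → ℝ} {lam H : ℝ} (hlam : 0 ≤ lam) (w : List Bool)
    (hmaps : ∀ b, ∀ y ∈ Icc (-1:ℝ) 1, branch f b y ∈ Icc (-1:ℝ) 1)
    (hcontr : ∀ b, ∀ y ∈ Icc (-1:ℝ) 1, ∀ z ∈ Icc (-1:ℝ) 1,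
      |h (branch f b y) - h (branch f b z)| ≤ lam * |h y - h z|)
    (hexp : ∀ y ∈ Icc (-1:ℝ) 1, ∀ z ∈ Icc (-1:ℝ) 1, |y - z| ≤ |h y - h z|)
    (hH : ∀ y ∈ Icc (-1:ℝ) 1, ∀ z ∈ Icc (-1:ℝ) 1, |h y - h z| ≤ H) :
    len (Iw f w) ≤ 2 * H * lam ^ w.length := by
  have key : ∀ y ∈ Icc (-1:ℝ) 1, gw f w y ∈ Icc (-1:ℝ) 1 ∧ ∀ z ∈ Icc (-1:ℝ) 1,
      |h (gw f w y) - h (gw f w z)| ≤ lam ^ w.length * H := by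
    induction w with
    | nil =>
      intro y hy
      refine ⟨hy, fun z hz => ?_⟩
      simpa [gw] using hH y hy z hz
    | cons b w ih =>
      intro y hy
      refine ⟨hmaps b _ (ih y hy).1, fun z hz => ?_⟩
      refine (hcontr b _ (ih y hy).1 _ (ih z hz).1).trans ?_
      rw [List.length_cons, pow_succ', mul_assoc]
      exact mul_le_mul_of_nonneg_left ((ih y hy).2 z hz) hlam
  have h0 : (0:ℝ) ∈ Icc (-1:ℝ) 1 := by norm_num
  have hsub : Iw f w ⊆ Icc (gw f w 0 - lam ^ w.length * H) (gw f w 0 + lam ^ w.length * H) := by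
    rintro _ ⟨y, hy, rfl⟩
    have := (hexp _ (key y hy).1 _ (key 0 h0).1).trans ((key y hy).2 0 h0)
    rw [abs_le] at this
    constructor <;> linarith
  have hH0 : 0 ≤ H := (abs_nonneg _).trans (hH 0 h0 0 h0)
  have := ENNReal.toReal_mono (by simp [Real.volume_Icc]) (measure_mono (μ := volume) hsub)
  rw [Real.volume_Icc, ENNReal.toReal_ofReal (by ring_nf; positivity)] at this
  unfold len
  linarith

lemma branch_spec {f : ℝ → ℝ} (hcont : ContinuousOn f (Icc (-1) 0))
    (heven : ∀ x, f (-x) = f x) (hm1 : f (-1) = -1) (h0 : 1 ≤ f 0) (b : Bool)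
    {y : ℝ} (hy : y ∈ Icc (-1:ℝ) 1) :
    f (branch f b y) = y ∧ branch f b y ∈ (if b then Icc (0:ℝ) 1 else Icc (-1:ℝ) 0) := by
  obtain ⟨x, hx, rfl⟩ := intermediate_value_Icc (by norm_num) hcont
    (show y ∈ Icc (f (-1)) (f 0) from ⟨hm1.trans_le hy.1, hy.2.trans h0⟩)
  cases b
  · have hex : ∃ a ∈ Icc (-1:ℝ) 0, f a = f x := ⟨x, hx, rfl⟩
    exact ⟨Function.invFunOn_eq hex, Function.invFunOn_mem hex⟩
  · have hex : ∃ a ∈ Icc (0:ℝ) 1, f a = f x :=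
      ⟨-x, ⟨by linarith [hx.2], by linarith [hx.1]⟩, heven x⟩
    exact ⟨Function.invFunOn_eq hex, Function.invFunOn_mem hex⟩

lemma weightPrimitive_sub_le {f D : ℝ → ℝ} {r lam x y : ℝ} (hr : -1 < r)
    (hcont : ContinuousOn f (Icc (-1) 0)) (hmono : StrictMonoOn f (Icc (-1) 0))
    (hm1 : f (-1) = -1) (hD : ∀ x ∈ Ioo (-1:ℝ) 0, HasDerivAt f (D x) x)
    (hineq : ∀ x ∈ Ioo (-1:ℝ) 0, f x < 1 →
      (1 - x ^ 2) ^ r ≤ lam * ((1 - f x ^ 2) ^ r * D x))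
    (hx : x ∈ Icc (-1:ℝ) 0) (hy : y ∈ Icc (-1:ℝ) 0) (hxy : x ≤ y) (hfy : f y ≤ 1) :
    weightPrimitive r y - weightPrimitive r x ≤
      lam * (weightPrimitive r (f y) - weightPrimitive r (f x)) := by
  have hsub : Icc x y ⊆ Icc (-1) 0 := Icc_subset_Icc hx.1 hy.2
  have hleft : (-1:ℝ) ∈ Icc (-1:ℝ) 0 := by norm_num
  have hmaps : MapsTo f (Icc x y) (Icc (-1) 1) := by
    intro z hz
    refine ⟨?_, (hmono.monotoneOn (hsub hz) hy hz.2).trans hfy⟩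
    rw [← hm1]
    exact hmono.monotoneOn hleft (hsub hz) (hx.1.trans hz.1)
  have h : MonotoneOn (fun z => lam * weightPrimitive r (f z) - weightPrimitive r z)
      (Icc x y) := by
    have hval : ∀ z ∈ Ioo x y, z ∈ Ioo (-1:ℝ) 0 ∧ f z ∈ Ioo (-1:ℝ) 1 := by
      intro z hz
      have hz' : z ∈ Ioo (-1:ℝ) 0 := ⟨hx.1.trans_lt hz.1, hz.2.trans_le hy.2⟩
      refine ⟨hz', ?_, (hmono (Ioo_subset_Icc_self hz') hy hz.2).trans_le hfy⟩
      rw [← hm1]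
      exact hmono hleft (Ioo_subset_Icc_self hz') hz'.1
    refine monotoneOn_of_hasDerivWithinAt_nonneg (convex_Icc _ _)
      (f' := fun z => lam * ((1 - f z ^ 2) ^ r * D z) - (1 - z ^ 2) ^ r) ?_ ?_ ?_
    · refine ContinuousOn.sub (continuousOn_const.mul ?_) ?_
      · exact (continuousOn_weightPrimitive hr).comp (hcont.mono hsub) hmaps
      · exact (continuousOn_weightPrimitive hr).mono
          (hsub.trans (Icc_subset_Icc_right (by norm_num)))
    · intro z hz
      rw [interior_Icc] at hz ⊢
      obtain ⟨h1, h2⟩ := hval z hz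
      exact ((((hasDerivAt_weightPrimitive hr h2).comp z (hD z h1)).const_mul lam).sub
        (hasDerivAt_weightPrimitive hr ⟨h1.1, by linarith [h1.2]⟩)).hasDerivWithinAt
    · intro z hz
      rw [interior_Icc] at hz
      obtain ⟨h1, h2⟩ := hval z hz
      exact sub_nonneg.2 (hineq z h1 h2.2)
  have := h (left_mem_Icc.2 hxy) (right_mem_Icc.2 hxy) hxy
  simp only at this
  linarith

/-- Exponential decay of the partition lengths of an even unimodal map contracting the weight
`(1 - u ^ 2) ^ r` along inverse branches. -/
lemma len_Iw_le {f D : ℝ → ℝ} {r lam : ℝ} (hr : -1 < r) (hr0 : r ≤ 0) (hlam : 0 ≤ lam)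
    (hcont : ContinuousOn f (Icc (-1) 0)) (hmono : StrictMonoOn f (Icc (-1) 0))
    (heven : ∀ x, f (-x) = f x) (hm1 : f (-1) = -1) (h0 : 1 ≤ f 0)
    (hD : ∀ x ∈ Ioo (-1:ℝ) 0, HasDerivAt f (D x) x)
    (hineq : ∀ x ∈ Ioo (-1:ℝ) 0, f x < 1 →
      (1 - x ^ 2) ^ r ≤ lam * ((1 - f x ^ 2) ^ r * D x)) (w : List Bool) :
    len (Iw f w) ≤ 2 * (2 * weightPrimitive r 1) * lam ^ w.length := by
  have hone : ∀ y ∈ Icc (-1:ℝ) 1, |weightPrimitive r y| ≤ weightPrimitive r 1 := by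
    intro y hy
    have h1 := sub_le_weightPrimitive_sub hr hr0 hy (y := 1) (by norm_num) hy.2
    have h2 := sub_le_weightPrimitive_sub hr hr0 (x := -1) (by norm_num) hy hy.1
    rw [weightPrimitive_neg] at h2
    rw [abs_le]
    constructor <;> linarith [hy.1, hy.2]
  have hneg : ∀ x ∈ Icc (-1:ℝ) 0, ∀ y ∈ Icc (-1:ℝ) 0, f x ≤ 1 → f y ≤ 1 →
      |weightPrimitive r x - weightPrimitive r y| ≤
        lam * |weightPrimitive r (f x) - weightPrimitive r (f y)| := by
    intro x hx y hy hfx hfy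
    wlog hxy : x ≤ y generalizing x y
    · rw [abs_sub_comm (weightPrimitive r x), abs_sub_comm (weightPrimitive r (f x))]
      exact this y hy x hx hfy hfx (le_of_not_ge hxy)
    have h1 := weightPrimitive_sub_le hr hcont hmono hm1 hD hineq hx hy hxy hfy
    have h2 := sub_le_weightPrimitive_sub hr hr0 (x := x) (y := y)
      ⟨hx.1, by linarith [hx.2]⟩ ⟨hy.1, by linarith [hy.2]⟩ hxy
    rw [abs_sub_comm (weightPrimitive r x), abs_sub_comm (weightPrimitive r (f x)),
      abs_of_nonneg (by linarith)]
    exact h1.trans (mul_le_mul_of_nonneg_left (le_abs_self _) hlam)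
  refine len_Iw_le_of_contraction (h := weightPrimitive r) hlam w ?_ ?_
    (fun y hy z hz => abs_sub_le_abs_weightPrimitive_sub hr hr0 hy hz) ?_
  · intro b y hy
    have := (branch_spec hcont heven hm1 h0 b hy).2
    cases b
    · exact Icc_subset_Icc_right (by norm_num) this
    · exact Icc_subset_Icc_left (by norm_num) this
  · intro b y hy z hz
    obtain ⟨ey, my⟩ := branch_spec hcont heven hm1 h0 b hy
    obtain ⟨ez, mz⟩ := branch_spec hcont heven hm1 h0 b hz
    cases b
    · have := hneg _ my _ mz (ey.trans_le hy.2) (ez.trans_le hz.2)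
      rwa [ey, ez] at this
    · have := hneg (-branch f true y) ⟨by linarith [my.2], by linarith [my.1]⟩
        (-branch f true z) ⟨by linarith [mz.2], by linarith [mz.1]⟩
        (by rw [heven, ey]; exact hy.2) (by rw [heven, ez]; exact hz.2)
      rw [heven, heven, ey, ez, weightPrimitive_neg, weightPrimitive_neg, neg_sub_neg,
        abs_sub_comm] at this
      exact this
  · intro y hy z hz
    have h1 := hone y hy
    have h2 := hone z hz
    exact (abs_sub _ _).trans (by linarith)

lemma exists_contraction_exponent {c γ δ q : ℝ} (hγ : 1 < γ) (hc : 0 < c)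
    (hδ : δ ∈ Ioo (0:ℝ) 1) (hq : 1 < q) :
    ∃ a ∈ Ioo (0:ℝ) 1, ∃ lam ∈ Ioo (0:ℝ) 1, ∀ t ∈ Ioo (0:ℝ) 1, ∀ d : ℝ,
      c * t ^ (γ - 1) ≤ d → (1 - δ ≤ t → q ≤ d) →
      (2 * t / (1 + t)) ^ (1 - a) ≤ lam * d ^ a := by
  obtain ⟨hδ0, hδ1⟩ := hδ
  set s₀ := 2 * (1 - δ) / (1 + (1 - δ)) with hs₀
  have hs₀pos : 0 < s₀ := div_pos (by linarith) (by linarith)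
  have hs₀lt : s₀ < 1 := (div_lt_one (by linarith)).2 (by linarith)
  set θ : ℝ → ℝ := fun a => (2:ℝ) ^ (a * (γ - 1)) * s₀ ^ (1 - a * γ) * (c ^ a)⁻¹ with hθ
  have hθc : ContinuousAt θ 0 := by
    have h1 : Continuous θ := by
      refine ((Continuous.rpow continuous_const (by fun_prop) fun _ => Or.inl (by norm_num)).mul
        (Continuous.rpow continuous_const (by fun_prop) fun _ => Or.inl hs₀pos.ne')).mul
        (Continuous.inv₀ (Continuous.rpow continuous_const continuous_id fun _ => Or.inl hc.ne')
          fun a => (Real.rpow_pos_of_pos hc a).ne')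
    exact h1.continuousAt
  have hθ0 : θ 0 < (1 + s₀) / 2 := by simp [hθ]; linarith
  have hev : ∀ᶠ a in 𝓝[>] (0:ℝ), θ a < (1 + s₀) / 2 :=
    (hθc.eventually_lt continuousAt_const hθ0).filter_mono nhdsWithin_le_nhds
  obtain ⟨a, hθa, ha0, haγ⟩ :=
    (hev.and (Ioo_mem_nhdsGT (show (0:ℝ) < 1 / γ by positivity))).exists
  rw [lt_div_iff₀ (by linarith)] at haγ
  have ha1 : a < 1 := by nlinarith
  refine ⟨a, ⟨ha0, ha1⟩, max ((1 + s₀) / 2) (q ^ a)⁻¹, ⟨?_, ?_⟩, ?_⟩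
  · exact lt_max_of_lt_left (by linarith)
  · exact max_lt (by linarith) (inv_lt_one_of_one_lt₀ (Real.one_lt_rpow hq ha0))
  intro t ht d hd hdq
  have hs0 : 0 < 2 * t / (1 + t) := div_pos (by linarith [ht.1]) (by linarith [ht.1])
  rcases le_or_gt (1 - δ) t with h | h
  · have hqd := hdq h
    have hd0 : 0 ≤ d := by linarith
    calc (2 * t / (1 + t)) ^ (1 - a) ≤ 1 :=
          Real.rpow_le_one hs0.le ((div_le_one (by linarith [ht.1])).2 (by linarith [ht.2]))
            (by linarith)
      _ = (q ^ a)⁻¹ * q ^ a := (inv_mul_cancel₀ (Real.rpow_pos_of_pos (by linarith) a).ne').symm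
      _ ≤ _ := by
        gcongr
        exact le_max_right _ _
  · have hs2 : 2 * t / (1 + t) ≤ 2 * t := div_le_self (by linarith [ht.1]) (by linarith [ht.1])
    have hss : 2 * t / (1 + t) ≤ s₀ := by
      rw [hs₀, div_le_div_iff₀ (by linarith [ht.1]) (by linarith)]
      nlinarith
    have ht0 := ht.1
    calc (2 * t / (1 + t)) ^ (1 - a)
        = (2 * t / (1 + t)) ^ (a * (γ - 1)) * (2 * t / (1 + t)) ^ (1 - a * γ) := by
          rw [← Real.rpow_add hs0]
          ring_nf
      _ ≤ (2 * t) ^ (a * (γ - 1)) * s₀ ^ (1 - a * γ) := by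
          have : 0 ≤ a * (γ - 1) := mul_nonneg ha0.le (by linarith)
          have : 0 ≤ 1 - a * γ := by linarith
          gcongr
      _ = θ a * (c * t ^ (γ - 1)) ^ a := by
          rw [Real.mul_rpow (by norm_num) ht0.le, Real.mul_rpow hc.le (by positivity),
            ← Real.rpow_mul ht0.le, mul_comm (γ - 1) a]
          have := (Real.rpow_pos_of_pos hc a).ne'
          simp only [hθ]
          field_simp
      _ ≤ _ := by
          gcongr
          exact hθa.le.trans (le_max_left _ _)

lemma weight_le_of_cross_ratio {t y d ε a lam : ℝ} (ht : t ∈ Ioo (0:ℝ) 1)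
    (hy : y ∈ Ioo (-1:ℝ) 1) (hd : 0 < d) (hε : 0 ≤ ε) (ha : a < 1)
    (hcross : (1 + y) * (1 + ε - y) ≤ (2 + ε) * d * ((1 - t) * t))
    (hlam : (2 * t / (1 + t)) ^ (1 - a) ≤ lam * d ^ a) :
    (1 - t ^ 2) ^ (a - 1) ≤ lam * ((1 - y ^ 2) ^ (a - 1) * d) := by
  obtain ⟨ht0, ht1⟩ := ht
  obtain ⟨hy0, hy1⟩ := hy
  have hT : 0 < 1 - t ^ 2 := by nlinarith
  have hY : 0 < 1 - y ^ 2 := by nlinarith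
  have hs0 : 0 < 2 * t / (1 + t) := by positivity
  have hQ : 1 - y ^ 2 ≤ 2 * t / (1 + t) * d * (1 - t ^ 2) := by
    have e : 2 * t / (1 + t) * d * (1 - t ^ 2) = 2 * d * ((1 - t) * t) := by
      field_simp
      ring
    rw [e]
    have h1 : (1 - y) * (2 + ε) ≤ 2 * (1 + ε - y) := by nlinarith
    have h2 := mul_le_mul_of_nonneg_left h1 (show 0 ≤ 1 + y by linarith)
    nlinarith
  have key : (1 - y ^ 2) ^ (1 - a) ≤ lam * d * (1 - t ^ 2) ^ (1 - a) := by
    calc (1 - y ^ 2) ^ (1 - a) ≤ (2 * t / (1 + t) * d * (1 - t ^ 2)) ^ (1 - a) :=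
          Real.rpow_le_rpow hY.le hQ (by linarith)
      _ = (2 * t / (1 + t)) ^ (1 - a) * d ^ (1 - a) * (1 - t ^ 2) ^ (1 - a) := by
          rw [Real.mul_rpow (by positivity) hT.le, Real.mul_rpow hs0.le hd.le]
      _ ≤ lam * d ^ a * d ^ (1 - a) * (1 - t ^ 2) ^ (1 - a) := by gcongr
      _ = _ := by rw [mul_assoc lam, ← Real.rpow_add hd, add_sub_cancel, Real.rpow_one]
  have e1 : (1 - t ^ 2) ^ (a - 1) = ((1 - t ^ 2) ^ (1 - a))⁻¹ := by
    rw [← Real.rpow_neg hT.le, neg_sub]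
  have e2 : (1 - y ^ 2) ^ (a - 1) = ((1 - y ^ 2) ^ (1 - a))⁻¹ := by
    rw [← Real.rpow_neg hY.le, neg_sub]
  have hT' := Real.rpow_pos_of_pos hT (1 - a)
  have hY' := Real.rpow_pos_of_pos hY (1 - a)
  rw [e1, e2, show lam * (((1 - y ^ 2) ^ (1 - a))⁻¹ * d) = lam * d / (1 - y ^ 2) ^ (1 - a) by
    ring, inv_eq_one_div, div_le_div_iff₀ hT' hY', one_mul]
  exact key

lemma rpow_sub_rpow_le_mul {r x y : ℝ} (hr : 1 ≤ r) (hx : 0 ≤ x) (hxy : x ≤ y) (hy : y ≤ 1) :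
    y ^ r - x ^ r ≤ r * (y - x) := by
  rcases hxy.eq_or_lt with rfl | hlt
  · simp
  have hy0 : 0 < y := hx.trans_lt hlt
  have h := one_add_mul_self_le_rpow_one_add (s := x / y - 1) (p := r)
    (by have := div_nonneg hx hy0.le; linarith) hr
  rw [add_sub_cancel, Real.div_rpow hx hy0.le] at h
  have h2 := mul_le_mul_of_nonneg_right h (Real.rpow_nonneg hy0.le r)
  rw [div_mul_cancel₀ _ (Real.rpow_pos_of_pos hy0 r).ne'] at h2
  have h3 : y ^ r ≤ y := by
    simpa using Real.rpow_le_rpow_of_exponent_ge hy0 hy hr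
  have h4 : y ^ r * (1 - x / y) ≤ y * (1 - x / y) := by
    have : x / y ≤ 1 := (div_le_one hy0).2 hxy
    exact mul_le_mul_of_nonneg_right h3 (by linarith)
  have h5 : y * (1 - x / y) = y - x := by field_simp
  rw [h5] at h4
  nlinarith

lemma rpow_sub_rpow_le_mul_rpow_min {r x y : ℝ} (hr : 0 < r) (hx : 0 ≤ x) (hxy : x ≤ y)
    (hy : y ≤ 1) : y ^ r - x ^ r ≤ (1 + r) * (y - x) ^ min 1 r := by
  rcases le_total 1 r with h | h
  · rw [min_eq_left h, Real.rpow_one]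
    linarith [rpow_sub_rpow_le_mul h hx hxy hy]
  · rw [min_eq_right h]
    have h1 := Real.rpow_add_le_add_rpow hx (sub_nonneg.2 hxy) hr.le h
    rw [add_sub_cancel] at h1
    nlinarith [Real.rpow_nonneg (sub_nonneg.2 hxy) r]

lemma abs_rpow_mul_self_of_nonneg {γ x : ℝ} (hγ : 1 < γ) (hx : 0 ≤ x) :
    |x| ^ (γ - 2) * x = x ^ (γ - 1) := by
  rcases hx.eq_or_lt with rfl | h
  · rw [mul_zero, Real.zero_rpow (by linarith)]
  · rw [abs_of_pos h, ← Real.rpow_add_one h.ne']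
    ring_nf

lemma abs_abs_rpow_mul_self_sub_le {γ x y : ℝ} (hγ : 1 < γ) (hx : x ∈ Icc (-1:ℝ) 1)
    (hy : y ∈ Icc (-1:ℝ) 1) :
    |(|x| ^ (γ - 2) * x - |y| ^ (γ - 2) * y)| ≤ (1 + γ) * |x - y| ^ min 1 (γ - 1) := by
  wlog hxy : x ≤ y generalizing x y
  · rw [abs_sub_comm, abs_sub_comm x]
    exact this hy hx (le_of_not_ge hxy)
  have hr : 0 < γ - 1 := by linarith
  have hβ : 0 ≤ min 1 (γ - 1) := le_min zero_le_one hr.le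
  have hneg : ∀ z : ℝ, |z| ^ (γ - 2) * z = -(|(-z)| ^ (γ - 2) * (-z)) := by
    intro z; rw [abs_neg]; ring
  have hP := Real.rpow_nonneg (sub_nonneg.2 hxy) (min 1 (γ - 1))
  rw [abs_sub_comm x, abs_of_nonneg (sub_nonneg.2 hxy), abs_sub_comm]
  rcases le_total 0 x with h0x | hx0
  · rw [abs_rpow_mul_self_of_nonneg hγ h0x, abs_rpow_mul_self_of_nonneg hγ (h0x.trans hxy),
      abs_of_nonneg (sub_nonneg.2 (Real.rpow_le_rpow h0x hxy hr.le))]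
    have := rpow_sub_rpow_le_mul_rpow_min hr h0x hxy hy.2
    linarith
  rcases le_total y 0 with hy0 | h0y
  · rw [hneg x, hneg y, abs_rpow_mul_self_of_nonneg hγ (neg_nonneg.2 hx0),
      abs_rpow_mul_self_of_nonneg hγ (neg_nonneg.2 hy0), neg_sub_neg,
      abs_of_nonneg (sub_nonneg.2 (Real.rpow_le_rpow (by linarith) (by linarith) hr.le))]
    have := rpow_sub_rpow_le_mul_rpow_min hr (neg_nonneg.2 hy0) (neg_le_neg hxy)
      (by linarith [hx.1])
    rw [neg_sub_neg] at this
    linarith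
  · have hbound : ∀ z : ℝ, 0 ≤ z → z ≤ 1 → z ≤ y - x →
        z ^ (γ - 1) ≤ (y - x) ^ min 1 (γ - 1) := by
      intro z hz0 hz1 hz
      exact (Real.rpow_le_rpow_of_exponent_ge_of_imp hz0 hz1 (min_le_right 1 (γ - 1))
        (fun _ h => absurd h hr.ne')).trans (Real.rpow_le_rpow hz0 hz hβ)
    rw [hneg x, abs_rpow_mul_self_of_nonneg hγ (neg_nonneg.2 hx0),
      abs_rpow_mul_self_of_nonneg hγ h0y, sub_neg_eq_add,
      abs_of_nonneg (add_nonneg (Real.rpow_nonneg h0y _) (Real.rpow_nonneg (by linarith) _))]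
    have h1 := hbound y h0y hy.2 (by linarith)
    have h2 := hbound (-x) (by linarith) (by linarith [hx.1]) (by linarith)
    nlinarith

lemma abs_abs_rpow_sub_le {γ x y : ℝ} (hγ : 1 ≤ γ) (hx : |x| ≤ 1) (hy : |y| ≤ 1) :
    |(|x| ^ γ - |y| ^ γ)| ≤ γ * |x - y| := by
  wlog hxy : |x| ≤ |y| generalizing x y
  · rw [abs_sub_comm, abs_sub_comm x]
    exact this hy hx (le_of_not_ge hxy)
  have h0 := Real.rpow_le_rpow (abs_nonneg x) hxy (show 0 ≤ γ by linarith)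
  rw [abs_sub_comm, abs_of_nonneg (by linarith), abs_sub_comm x]
  refine (rpow_sub_rpow_le_mul hγ (abs_nonneg x) hxy hy).trans ?_
  exact mul_le_mul_of_nonneg_left (abs_sub_abs_le_abs_sub y x) (by linarith)

lemma contDiffOn_partial_snd {F F' : ℝ → ℝ → ℝ} {s t : Set ℝ} (hs : UniqueDiffOn ℝ s)
    (ht : UniqueDiffOn ℝ t) (hF : ContDiffOn ℝ 2 (fun p : ℝ × ℝ => F p.1 p.2) (s ×ˢ t))
    (hd : ∀ ε ∈ s, ∀ x ∈ t, HasDerivWithinAt (F ε) (F' ε x) t x) :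
    ContDiffOn ℝ 1 (fun p : ℝ × ℝ => F' p.1 p.2) (s ×ˢ t) := by
  have h1 := hF.fderivWithin (m := 1) (hs.prod ht) (by norm_num)
  refine (h1.clm_apply (contDiffOn_const (c := ((0:ℝ), (1:ℝ))))).congr ?_
  rintro ⟨ε, x⟩ ⟨hε, hx⟩
  have h2 := (hF.differentiableOn (by norm_num) (ε, x) ⟨hε, hx⟩).hasFDerivWithinAt
  have h3 : HasDerivWithinAt (fun y : ℝ => (ε, y)) ((0:ℝ), (1:ℝ)) t x :=
    (hasDerivWithinAt_const x t ε).prodMk (hasDerivWithinAt_id x t)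
  have h4 := h2.comp_hasDerivWithinAt x h3 (fun y hy => ⟨hε, hy⟩)
  exact (ht x hx).eq_deriv _ (hd ε hε x hx) h4

lemma exists_lipschitz_of_contDiffOn {G : ℝ × ℝ → ℝ} {s t : Set ℝ} (hs : UniqueDiffOn ℝ s)
    (ht : UniqueDiffOn ℝ t) (hsc : Convex ℝ s) (htc : Convex ℝ t) (hsk : IsCompact s)
    (htk : IsCompact t) (hG : ContDiffOn ℝ 1 G (s ×ˢ t)) :
    ∃ L > 0, ∀ ε ∈ s, ∀ x ∈ t, ∀ y ∈ t, |G (ε, x) - G (ε, y)| ≤ L * |x - y| := by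
  obtain ⟨C, hC⟩ := (hsk.prod htk).exists_bound_of_continuousOn
    (hG.continuousOn_fderivWithin (hs.prod ht) le_rfl)
  refine ⟨max C 1, by positivity, fun ε hε x hx y hy => ?_⟩
  have := (hsc.prod htc).norm_image_sub_le_of_norm_fderivWithin_le
    (hG.differentiableOn (by norm_num)) (fun p hp => (hC p hp).trans (le_max_left C 1))
    (show (ε, y) ∈ s ×ˢ t from ⟨hε, hy⟩) (show (ε, x) ∈ s ×ˢ t from ⟨hε, hx⟩)
  simpa [Prod.norm_def] using this

lemma exists_lower_bound_near_one {D : ℝ × ℝ → ℝ} {s : Set ℝ} (hs : IsCompact s)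
    (hne : s.Nonempty) (hD : ContinuousOn D (s ×ˢ Icc 0 1)) (h1 : ∀ ε ∈ s, 1 < D (ε, 1)) :
    ∃ q > 1, ∃ δ ∈ Ioo (0:ℝ) 1, ∀ ε ∈ s, ∀ t ∈ Icc (0:ℝ) 1, 1 - δ ≤ t → q ≤ D (ε, t) := by
  have hone : (1:ℝ) ∈ Icc (0:ℝ) 1 := by norm_num
  have hc : ContinuousOn (fun ε => D (ε, 1)) s :=
    hD.comp (by fun_prop) (fun ε hε => ⟨hε, hone⟩)
  obtain ⟨ε₁, hε₁, hmin⟩ := hs.exists_isMinOn hne hc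
  have hq₀ := h1 ε₁ hε₁
  have hu := (hs.prod isCompact_Icc).uniformContinuousOn_of_continuous hD
  obtain ⟨δ, hδ, hδu⟩ := Metric.uniformContinuousOn_iff.1 hu ((D (ε₁, 1) - 1) / 2) (by linarith)
  refine ⟨(1 + D (ε₁, 1)) / 2, by linarith, min (δ / 2) (1 / 2),
    ⟨by positivity, (min_le_right _ _).trans_lt (by norm_num)⟩, fun ε hε t ht htδ => ?_⟩
  have hdist : dist ((ε, t) : ℝ × ℝ) (ε, 1) < δ := by
    rw [Prod.dist_eq, dist_self, Real.dist_eq, abs_of_nonpos (by linarith [ht.2])]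
    refine max_lt hδ ?_
    linarith [min_le_left (δ / 2) (1 / 2 : ℝ)]
  have h2 := hδu _ ⟨hε, ht⟩ _ ⟨hε, hone⟩ hdist
  rw [Real.dist_eq, abs_lt] at h2
  have h3 : D (ε₁, 1) ≤ D (ε, 1) := hmin hε
  linarith [h2.1]

lemma neg_abs_rpow_mem_Icc {γ x : ℝ} (hγ : 0 ≤ γ) (hx : x ∈ Icc (-1:ℝ) 1) :
    -(|x| ^ γ) ∈ Icc (-1:ℝ) 0 := by
  have h1 := Real.rpow_le_one (abs_nonneg x) (abs_le.2 hx) hγ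
  have h2 := Real.rpow_nonneg (abs_nonneg x) γ
  constructor <;> linarith

lemma abs_rpow_mul_self_div_of_pos {γ x : ℝ} (hx : 0 < x) :
    |x| ^ (γ - 2) * x / |x| ^ (γ - 1) = 1 := by
  rw [abs_of_pos hx, ← Real.rpow_add_one hx.ne', show γ - 2 + 1 = γ - 1 by ring,
    div_self (Real.rpow_pos_of_pos hx _).ne']

lemma abs_rpow_mul_self_div_of_neg {γ x : ℝ} (hx : x < 0) :
    |x| ^ (γ - 2) * x / |x| ^ (γ - 1) = -1 := by
  have := abs_rpow_mul_self_div_of_pos (γ := γ) (neg_pos.2 hx)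
  rw [abs_neg, mul_neg, neg_div] at this
  linarith

lemma abs_sub_le_two_mul_rpow {x y β : ℝ} (hx : x ∈ Icc (-1:ℝ) 1) (hy : y ∈ Icc (-1:ℝ) 1)
    (hβ : β ∈ Ioc (0:ℝ) 1) : |x - y| ≤ 2 * |x - y| ^ β := by
  have h2 : |x - y| ≤ 2 := by
    rw [abs_le]; constructor <;> linarith [hx.1, hx.2, hy.1, hy.2]
  rcases (abs_nonneg (x - y)).eq_or_lt with h | h
  · rw [← h]; positivity
  · calc |x - y| = |x - y| ^ (1 - β) * |x - y| ^ β := by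
          rw [← Real.rpow_add h, sub_add_cancel, Real.rpow_one]
      _ ≤ 2 * |x - y| ^ β := by
          gcongr
          calc |x - y| ^ (1 - β) ≤ 2 ^ (1 - β) :=
                Real.rpow_le_rpow h.le h2 (by linarith [hβ.2])
            _ ≤ 2 ^ (1:ℝ) :=
                Real.rpow_le_rpow_of_exponent_le (by norm_num) (by linarith [hβ.1])
            _ = 2 := Real.rpow_one 2

/-- The cross-ratio inequality survives precomposition with the power map `x ↦ -(-x) ^ γ`. -/
lemma cross_ratio_comp_neg_rpow {A B d L γ t : ℝ} (hγ : 1 ≤ γ) (ht : t ∈ Ioo (0:ℝ) 1)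
    (hd : 0 ≤ d) (hL : 0 ≤ L) (h : A * B ≤ L * d * (1 - t ^ γ) * t ^ γ) :
    A * B ≤ L * (γ * t ^ (γ - 1) * d) * ((1 - t) * t) := by
  obtain ⟨ht0, ht1⟩ := ht
  have hb := one_add_mul_self_le_rpow_one_add (s := t - 1) (p := γ) (by linarith) hγ
  rw [add_sub_cancel] at hb
  have he : t ^ γ = t ^ (γ - 1) * t := by
    rw [← Real.rpow_add_one ht0.ne', sub_add_cancel]
  have hpos : 0 ≤ L * d * t ^ γ := by positivity
  have h2 := mul_le_mul_of_nonneg_left (show 1 - t ^ γ ≤ γ * (1 - t) by linarith) hpos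
  calc A * B ≤ L * d * (1 - t ^ γ) * t ^ γ := h
    _ = L * d * t ^ γ * (1 - t ^ γ) := by ring
    _ ≤ L * d * t ^ γ * (γ * (1 - t)) := h2
    _ = _ := by rw [he]; ring

/-- Proposition 1: if `{F_ε}` is a family of C³ embeddings of `[-1,0]`
with nonpositive Schwarzian derivative, fixing `-1`, mapping `0` to `1+ε`, with
`F_ε'(-1) > 1/γ`, jointly C², then `f_ε(x) = F_ε(-|x|^γ)` is a good family (in particular
the maximal lengths of the partitions decay exponentially, uniformly in `ε`). -/
theorem schwarzian_family_is_good (eps0 : ℝ) (heps0 : 0 < eps0) (γ : ℝ) (hγ : 1 < γ)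
    (F F' F'' F''' : ℝ → ℝ → ℝ)
    (hd1 : ∀ ε ∈ Icc 0 eps0, ∀ x ∈ Icc (-1:ℝ) 0,
      HasDerivWithinAt (F ε) (F' ε x) (Icc (-1) 0) x)
    (hd2 : ∀ ε ∈ Icc 0 eps0, ∀ x ∈ Icc (-1:ℝ) 0,
      HasDerivWithinAt (F' ε) (F'' ε x) (Icc (-1) 0) x)
    (hd3 : ∀ ε ∈ Icc 0 eps0, ∀ x ∈ Icc (-1:ℝ) 0,
      HasDerivWithinAt (F'' ε) (F''' ε x) (Icc (-1) 0) x)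
    (hcont3 : ∀ ε ∈ Icc 0 eps0, ContinuousOn (F''' ε) (Icc (-1) 0))
    (hemb : ∀ ε ∈ Icc 0 eps0, Set.InjOn (F ε) (Icc (-1) 0))
    (hne : ∀ ε ∈ Icc 0 eps0, ∀ x ∈ Icc (-1:ℝ) 0, F' ε x ≠ 0)
    (hschwarz : ∀ ε ∈ Icc 0 eps0, ∀ x ∈ Icc (-1:ℝ) 0,
      F''' ε x / F' ε x - (3 / 2) * (F'' ε x / F' ε x) ^ 2 ≤ 0)
    (hfix : ∀ ε ∈ Icc 0 eps0, F ε (-1) = -1)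
    (hmap0 : ∀ ε ∈ Icc 0 eps0, F ε 0 = 1 + ε)
    (hexp : ∀ ε ∈ Icc 0 eps0, F' ε (-1) > 1 / γ)
    (hC2 : ContDiffOn ℝ 2 (fun p : ℝ × ℝ => F p.1 p.2) (Icc 0 eps0 ×ˢ Icc (-1) 0)) :
    ∃ G : GoodFamily, G.eps0 = eps0 ∧ G.gamma = γ ∧
      ∀ ε x : ℝ, G.f ε x = F ε (-(|x| ^ γ)) := by
  have hI : UniqueDiffOn ℝ (Icc 0 eps0) := uniqueDiffOn_Icc heps0
  have hJ : UniqueDiffOn ℝ (Icc (-1:ℝ) 0) := uniqueDiffOn_Icc (by norm_num)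
  have hγ0 : 0 < γ := by linarith
  have hleft : (-1:ℝ) ∈ Icc (-1:ℝ) 0 := by norm_num
  have hright : (0:ℝ) ∈ Icc (-1:ℝ) 0 := by norm_num
  have hFc : ∀ ε ∈ Icc 0 eps0, ContinuousOn (F ε) (Icc (-1) 0) :=
    fun ε hε x hx => (hd1 ε hε x hx).continuousWithinAt
  have hFmono : ∀ ε ∈ Icc 0 eps0, StrictMonoOn (F ε) (Icc (-1) 0) := by
    intro ε hε
    refine ContinuousOn.strictMonoOn_of_injOn_Icc (by norm_num) ?_ (hFc ε hε) (hemb ε hε)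
    rw [hfix ε hε, hmap0 ε hε]
    linarith [hε.1]
  have hF'pos : ∀ ε ∈ Icc 0 eps0, ∀ x ∈ Icc (-1:ℝ) 0, 0 < F' ε x := by
    intro ε hε x hx
    refine lt_of_le_of_ne ?_ (hne ε hε x hx).symm
    rw [← (hd1 ε hε x hx).derivWithin (hJ x hx)]
    exact (hFmono ε hε).monotoneOn.derivWithin_nonneg
  have hF'C1 := contDiffOn_partial_snd hI hJ hC2 hd1
  have hK : IsCompact (Icc 0 eps0 ×ˢ Icc (-1:ℝ) 0) := isCompact_Icc.prod isCompact_Icc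
  obtain ⟨L, hL, hLip⟩ := exists_lipschitz_of_contDiffOn hI hJ (convex_Icc _ _) (convex_Icc _ _)
    isCompact_Icc isCompact_Icc hF'C1
  obtain ⟨M, hM⟩ := hK.exists_bound_of_continuousOn hF'C1.continuousOn
  obtain ⟨c, hc, hcF'⟩ : ∃ c > 0, ∀ ε ∈ Icc 0 eps0, ∀ x ∈ Icc (-1:ℝ) 0, c ≤ F' ε x := by
    obtain ⟨p, hp, hmin⟩ := hK.exists_isMinOn ⟨(0, 0), ⟨le_rfl, heps0.le⟩, hright⟩
      hF'C1.continuousOn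
    exact ⟨F' p.1 p.2, hF'pos _ hp.1 _ hp.2, fun ε hε x hx => hmin (show (ε, x) ∈ _ from ⟨hε, hx⟩)⟩
  have hpow : ContDiff ℝ 1 (fun p : ℝ × ℝ => (p.1, -(|p.2| ^ γ))) := by
    have h1 : ContDiff ℝ 1 (fun x : ℝ => |x| ^ γ) := contDiff_norm_rpow (E := ℝ) hγ
    exact contDiff_fst.prodMk (h1.comp contDiff_snd).neg
  have hmem : ∀ x ∈ Icc (-1:ℝ) 1, -(|x| ^ γ) ∈ Icc (-1:ℝ) 0 :=
    fun x hx => neg_abs_rpow_mem_Icc hγ0.le hx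
  have hmaps : MapsTo (fun p : ℝ × ℝ => (p.1, -(|p.2| ^ γ))) (Icc 0 eps0 ×ˢ Icc (-1) 1)
      (Icc 0 eps0 ×ˢ Icc (-1) 0) := fun p hp => ⟨hp.1, hmem _ hp.2⟩
  have hRcont : ContinuousOn (fun p : ℝ × ℝ => F' p.1 (-(|p.2| ^ γ)))
      (Icc 0 eps0 ×ˢ Icc (-1) 1) :=
    hF'C1.continuousOn.comp hpow.continuous.continuousOn hmaps
  have hRLip : ∀ ε ∈ Icc 0 eps0, ∀ x ∈ Icc (-1:ℝ) 1, ∀ y ∈ Icc (-1:ℝ) 1,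
      |F' ε (-(|x| ^ γ)) - F' ε (-(|y| ^ γ))| ≤ L * γ * |x - y| := by
    intro ε hε x hx y hy
    refine (hLip ε hε _ (hmem x hx) _ (hmem y hy)).trans ?_
    rw [neg_sub_neg, abs_sub_comm, mul_assoc]
    exact mul_le_mul_of_nonneg_left (abs_abs_rpow_sub_le hγ.le (abs_le.2 hx) (abs_le.2 hy)) hL.le
  have hcomp : ∀ ε ∈ Icc 0 eps0, ∀ x ∈ Icc (-1:ℝ) 1,
      HasDerivWithinAt (fun x => F ε (-(|x| ^ γ)))
        (F' ε (-(|x| ^ γ)) * -(γ * (|x| ^ (γ - 2) * x))) (Icc (-1) 1) x := by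
    intro ε hε x hx
    have h1 := ((hasDerivAt_abs_rpow x hγ).neg).hasDerivWithinAt (s := Icc (-1) 1)
    rw [mul_assoc] at h1
    exact (hd1 ε hε _ (hmem x hx)).comp x h1 (fun y hy => hmem y hy)
  have hneg_mono : StrictMonoOn (fun x : ℝ => -(|x| ^ γ)) (Icc (-1) 0) := by
    intro x hx y hy hxy
    refine neg_lt_neg (Real.rpow_lt_rpow (abs_nonneg y) ?_ hγ0)
    rw [abs_of_nonpos hx.2, abs_of_nonpos hy.2]
    linarith
  have hf_mono : ∀ ε ∈ Icc 0 eps0, StrictMonoOn (fun x => F ε (-(|x| ^ γ))) (Icc (-1) 0) :=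
    fun ε hε => (hFmono ε hε).comp hneg_mono fun x hx => hmem x ⟨hx.1, hx.2.trans zero_le_one⟩
  have hdiv : ∀ ε x : ℝ, F' ε (-(|x| ^ γ)) * -(γ * (|x| ^ (γ - 2) * x)) / |x| ^ (γ - 1) =
      -(γ * F' ε (-(|x| ^ γ)) * (|x| ^ (γ - 2) * x / |x| ^ (γ - 1))) := fun ε x => by ring
  have hdiv_neg : ∀ ε x : ℝ, x < 0 →
      F' ε (-(|x| ^ γ)) * -(γ * (|x| ^ (γ - 2) * x)) / |x| ^ (γ - 1) =
        γ * F' ε (-(|x| ^ γ)) := fun ε x hx => by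
    rw [hdiv, abs_rpow_mul_self_div_of_neg hx]; ring
  have hdiv_pos : ∀ ε x : ℝ, 0 < x →
      F' ε (-(|x| ^ γ)) * -(γ * (|x| ^ (γ - 2) * x)) / |x| ^ (γ - 1) =
        -(γ * F' ε (-(|x| ^ γ))) := fun ε x hx => by
    rw [hdiv, abs_rpow_mul_self_div_of_pos hx, mul_one]
  have hf_neg_one : ∀ ε ∈ Icc 0 eps0, F ε (-(|(-1:ℝ)| ^ γ)) = -1 := fun ε hε => by
    simpa using hfix ε hε
  have hf_zero : ∀ ε ∈ Icc 0 eps0, F ε (-(|(0:ℝ)| ^ γ)) = 1 + ε := fun ε hε => by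
    simpa [Real.zero_rpow hγ0.ne'] using hmap0 ε hε
  obtain ⟨q, hq, δ, hδ, hqD⟩ := exists_lower_bound_near_one
    (D := fun p => γ * p.2 ^ (γ - 1) * F' p.1 (-(|p.2| ^ γ)))
    (isCompact_Icc (a := 0) (b := eps0)) ⟨0, le_rfl, heps0.le⟩
    ((continuousOn_const.mul (continuousOn_snd.rpow_const fun _ _ => Or.inr (by linarith))).mul
      (hRcont.mono (prod_mono_right (Icc_subset_Icc_left (by norm_num)))))
    (fun ε hε => by
      have := hexp ε hε
      rw [gt_iff_lt, div_lt_iff₀ hγ0] at this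
      simp only [Real.one_rpow, abs_one]
      linarith)
  obtain ⟨a, ha, lam, hlam, hcontr⟩ :=
    exists_contraction_exponent (c := γ * c) hγ (by positivity) hδ hq
  have hdecay : ∀ ε ∈ Icc 0 eps0, ∀ w : List Bool,
      len (Iw (fun x => F ε (-(|x| ^ γ))) w) ≤
        2 * (2 * weightPrimitive (a - 1) 1) * lam ^ w.length := by
    intro ε hε w
    have hcont : ContinuousOn (fun x => F ε (-(|x| ^ γ))) (Icc (-1) 1) :=
      fun x hx => (hcomp ε hε x hx).continuousWithinAt
    refine len_Iw_le (D := fun x => F' ε (-(|x| ^ γ)) * -(γ * (|x| ^ (γ - 2) * x)))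
      (by linarith [ha.1]) (by linarith [ha.2]) hlam.1.le
      (hcont.mono (Icc_subset_Icc_right zero_le_one)) (hf_mono ε hε)
      (fun x => by simp only [abs_neg]) (hf_neg_one ε hε)
      ((by linarith [hε.1] : (1:ℝ) ≤ 1 + ε).trans_eq (hf_zero ε hε).symm) ?_ ?_ w
    · intro x hx
      exact (hcomp ε hε x ⟨hx.1.le, hx.2.le.trans zero_le_one⟩).hasDerivAt
        (Icc_mem_nhds hx.1 (hx.2.trans zero_lt_one))
    · intro x hx hfx
      obtain ⟨t, rfl⟩ : ∃ t, x = -t := ⟨-x, by ring⟩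
      have ht : t ∈ Ioo (0:ℝ) 1 := ⟨by linarith [hx.2], by linarith [hx.1]⟩
      have hD : F' ε (-(|(-t)| ^ γ)) * -(γ * (|(-t)| ^ (γ - 2) * -t)) =
          γ * t ^ (γ - 1) * F' ε (-(t ^ γ)) := by
        rw [abs_neg, mul_neg (|t| ^ (γ - 2)), abs_rpow_mul_self_of_nonneg hγ ht.1.le, abs_of_pos ht.1]
        ring
      simp only [hD, neg_sq]
      simp only [abs_neg, abs_of_pos ht.1] at hfx ⊢
      have hT0 : 0 < t ^ γ := Real.rpow_pos_of_pos ht.1 γ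
      have hT1 : t ^ γ < 1 := Real.rpow_lt_one ht.1.le ht.2 hγ0
      have hu : -(t ^ γ) ∈ Ioo (-1:ℝ) 0 := ⟨by linarith, by linarith⟩
      have hF'u := hF'pos ε hε _ (Ioo_subset_Icc_self hu)
      have hnhds : ∀ y ∈ Ioo (-1:ℝ) 0, Icc (-1:ℝ) 0 ∈ 𝓝 y :=
        fun y hy => Icc_mem_nhds hy.1 hy.2
      have hcross := mul_sub_mul_sub_le_of_schwarzian_nonpos (hFc ε hε)
        (fun y hy => (hd1 ε hε y (Ioo_subset_Icc_self hy)).hasDerivAt (hnhds y hy))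
        (fun y hy => hF'pos ε hε y (Ioo_subset_Icc_self hy))
        (fun y hy => (hd2 ε hε y (Ioo_subset_Icc_self hy)).hasDerivAt (hnhds y hy))
        (fun y hy => (hd3 ε hε y (Ioo_subset_Icc_self hy)).hasDerivAt (hnhds y hy))
        (fun y hy => hschwarz ε hε y (Ioo_subset_Icc_self hy))
        (hFmono ε hε).monotoneOn hu
      rw [hfix ε hε, hmap0 ε hε] at hcross
      have hFu : -1 < F ε (-(t ^ γ)) := by
        have := hFmono ε hε hleft (Ioo_subset_Icc_self hu) hu.1
        rwa [hfix ε hε] at this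
      refine weight_le_of_cross_ratio ht ⟨hFu, hfx⟩
        (mul_pos (mul_pos hγ0 (Real.rpow_pos_of_pos ht.1 _)) hF'u) hε.1 ha.2
        (cross_ratio_comp_neg_rpow hγ.le ht hF'u.le (by linarith [hε.1])
          (by linear_combination hcross)) (hcontr t ht _ ?_ ?_)
      · have := hcF' ε hε _ (Ioo_subset_Icc_self hu)
        have h2 : 0 ≤ γ * t ^ (γ - 1) := mul_nonneg hγ0.le (Real.rpow_nonneg ht.1.le _)
        linarith [mul_le_mul_of_nonneg_left this h2]
      · intro h
        have := hqD ε hε t (Ioo_subset_Icc_self ht) h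
        simpa only [abs_of_pos ht.1] using this
  have hW : 0 < weightPrimitive (a - 1) 1 := by
    have h1 := sub_le_weightPrimitive_sub (r := a - 1) (x := 0) (y := 1) (by linarith [ha.1])
      (by linarith [ha.2]) (by norm_num) (by norm_num) zero_le_one
    have h2 : weightPrimitive (a - 1) 0 = 0 := intervalIntegral.integral_same
    linarith
  have hM0 : 0 ≤ M := (norm_nonneg _).trans (hM (0, 0) ⟨⟨le_rfl, heps0.le⟩, hright⟩)
  have hβ : min 1 (γ - 1) ∈ Ioc (0:ℝ) 1 :=
    ⟨lt_min zero_lt_one (by linarith), min_le_left _ _⟩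
  have hsub_neg : Icc (-1:ℝ) 0 ⊆ Icc (-1) 1 := Icc_subset_Icc_right zero_le_one
  have hsub_pos : Icc (0:ℝ) 1 ⊆ Icc (-1) 1 := Icc_subset_Icc_left (by norm_num)
  have hHolder'' : ∀ ε ∈ Icc 0 eps0, ∀ x ∈ Icc (-1:ℝ) 1, ∀ y ∈ Icc (-1:ℝ) 1,
      |γ * F' ε (-(|x| ^ γ)) - γ * F' ε (-(|y| ^ γ))| ≤ γ * (L * γ) * |x - y| ^ (1:ℝ) := by
    intro ε hε x hx y hy
    rw [← mul_sub, abs_mul, abs_of_pos hγ0, Real.rpow_one, mul_assoc]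
    exact mul_le_mul_of_nonneg_left (hRLip ε hε x hx y hy) hγ0.le
  refine ⟨{
    eps0 := eps0
    eps0_pos := heps0
    f := fun ε x => F ε (-(|x| ^ γ))
    f' := fun ε x => F' ε (-(|x| ^ γ)) * -(γ * (|x| ^ (γ - 2) * x))
    gamma := γ
    one_lt_gamma := hγ
    mono := hf_mono
    anti := ?_
    map_neg_one := hf_neg_one
    map_one := fun ε hε => by simpa using hfix ε hε
    map_zero := hf_zero
    smooth := (hC2.of_le (by norm_num)).comp hpow.contDiffOn hmaps
    deriv_f := hcomp
    Rneg := fun ε x => γ * F' ε (-(|x| ^ γ))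
    Rpos := fun ε x => -(γ * F' ε (-(|x| ^ γ)))
    Rneg_cont := continuousOn_const.mul (hRcont.mono (prod_mono_right hsub_neg))
    Rpos_cont := (continuousOn_const.mul (hRcont.mono (prod_mono_right hsub_pos))).neg
    Rneg_ne := fun ε hε x hx => mul_ne_zero hγ0.ne' (hne ε hε _ (hmem x (hsub_neg hx)))
    Rpos_ne := fun ε hε x hx =>
      neg_ne_zero.2 (mul_ne_zero hγ0.ne' (hne ε hε _ (hmem x (hsub_pos hx))))
    Rneg_eq := fun ε _ x hx => (hdiv_neg ε x hx.2).symm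
    Rpos_eq := fun ε _ x hx => (hdiv_pos ε x hx.1).symm
    K' := 2 * (L * γ * γ) + M * (γ * (1 + γ))
    K'_pos := by positivity
    alpha' := min 1 (γ - 1)
    alpha'_mem := hβ
    holder' := ?_
    K'' := γ * (L * γ)
    K''_pos := by positivity
    alpha'' := 1
    alpha''_mem := by norm_num
    holder''_neg := ?_
    holder''_pos := ?_
    C0 := 2 * (2 * weightPrimitive (a - 1) 1)
    C0_pos := by positivity
    lam := lam
    lam_mem := hlam
    decay := ?_ }, rfl, rfl, fun _ _ => rfl⟩
  · intro ε hε x hx y hy hxy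
    have := hf_mono ε hε (a := -y) (b := -x) ⟨by linarith [hy.2], by linarith [hy.1]⟩
      ⟨by linarith [hx.2], by linarith [hx.1]⟩ (neg_lt_neg hxy)
    simpa only [abs_neg] using this
  · intro ε hε x hx y hy
    set v : ℝ → ℝ := fun z => |z| ^ (γ - 2) * z with hv
    have hv1 : |v x| ≤ 1 := by
      rcases le_total 0 x with h | h
      · simp only [hv]
        rw [abs_rpow_mul_self_of_nonneg hγ h, abs_of_nonneg (Real.rpow_nonneg h _)]
        exact Real.rpow_le_one h hx.2 (by linarith)
      · have := abs_rpow_mul_self_of_nonneg hγ (neg_nonneg.2 h)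
        rw [abs_neg, mul_neg] at this
        simp only [hv]
        rw [← abs_neg, this, abs_of_nonneg (Real.rpow_nonneg (neg_nonneg.2 h) _)]
        exact Real.rpow_le_one (by linarith) (by linarith [hx.1]) (by linarith)
    have hv2 : |v x - v y| ≤ (1 + γ) * |x - y| ^ min 1 (γ - 1) :=
      abs_abs_rpow_mul_self_sub_le hγ hx hy
    have h1 := hRLip ε hε x hx y hy
    have h2 : |F' ε (-(|y| ^ γ))| ≤ M := hM (ε, _) ⟨hε, hmem y hy⟩
    have h3 := abs_sub_le_two_mul_rpow hx hy hβ
    calc |F' ε (-(|x| ^ γ)) * -(γ * v x) - F' ε (-(|y| ^ γ)) * -(γ * v y)|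
        = γ * |(F' ε (-(|x| ^ γ)) - F' ε (-(|y| ^ γ))) * v x +
            F' ε (-(|y| ^ γ)) * (v x - v y)| := by
          rw [← abs_of_pos hγ0, ← abs_mul, abs_of_pos hγ0, ← abs_neg]
          ring_nf
      _ ≤ γ * (|F' ε (-(|x| ^ γ)) - F' ε (-(|y| ^ γ))| * |v x| +
            |F' ε (-(|y| ^ γ))| * |v x - v y|) := by
          rw [← abs_mul, ← abs_mul]
          gcongr
          exact abs_add_le _ _
      _ ≤ γ * (L * γ * (2 * |x - y| ^ min 1 (γ - 1)) * 1 +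
            M * ((1 + γ) * |x - y| ^ min 1 (γ - 1))) := by
          have h4 := h1.trans (mul_le_mul_of_nonneg_left h3 (by positivity))
          gcongr
      _ = _ := by ring
  · intro ε hε x hx y hy
    rw [hdiv_neg ε x hx.2, hdiv_neg ε y hy.2]
    exact hHolder'' ε hε x (hsub_neg (Ico_subset_Icc_self hx)) y
      (hsub_neg (Ico_subset_Icc_self hy))
  · intro ε hε x hx y hy
    rw [hdiv_pos ε x hx.1, hdiv_pos ε y hy.1, neg_sub_neg, abs_sub_comm]
    exact hHolder'' ε hε x (hsub_pos (Ioc_subset_Icc_self hx)) y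
      (hsub_pos (Ioc_subset_Icc_self hy))
  · intro ε hε n _ w hw
    refine (hdecay ε hε w).trans ?_
    rw [hw]
    exact mul_le_mul_of_nonneg_left
      (pow_le_pow_of_le_one hlam.1.le hlam.2.le (Nat.le_succ n)) (by positivity)
end
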